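/- arXiv:math/0307248 — 3 statements merged into one kernel-verified Lean document; each statement's English description precedes it below -/
import Mathlib

section
/- Let (e,h,f) be a θ-adapted sl2-triple in g. Then dim (z(e) ∩ g_i) = dim (z(f) ∩ g_{−i}) for every i ∈ ℤ/mℤ. -/
open LieAlgebra Module

variable (k : Type*) [Field k] [IsAlgClosed k] [CharZero k]
variable (g : Type*) [LieRing g] [LieAlgebra k g] [FiniteDimensional k g]
  [LieAlgebra.IsSemisimple k g]

/-- The `ζ^i`-eigenspace of the automorphism `θ`, i.e. the graded piece `g_i`. -/
noncomputable def gradePiece {m : ℕ} (ζ : k) (θ : g ≃ₗ[k] g) (i : ZMod m) : Submodule k g :=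
  Module.End.eigenspace (θ : g →ₗ[k] g) (ζ ^ i.val)

/-- The centraliser `z(x) = {y : ⁅x, y⁆ = 0}` of `x`. -/
noncomputable def zc (x : g) : Submodule k g := LinearMap.ker (LieAlgebra.ad k g x)

/-- Truncated exponential of an endomorphism; it agrees with the exponential series for
nilpotent endomorphisms of a finite-dimensional space. -/
noncomputable def expEnd (N : Module.End k g) : Module.End k g :=
  ∑ i ∈ Finset.range (Module.finrank k g + 1), ((i.factorial : k))⁻¹ • N ^ i

/-- The group `Int g` of inner automorphisms: the subgroup of the automorphism group
generated by `exp (ad n)` for `n` with `ad n` nilpotent. -/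
noncomputable def IntG : Subgroup (g ≃ₗ[k] g) :=
  Subgroup.closure {τ | ∃ n : g, IsNilpotent (LieAlgebra.ad k g n) ∧
    (τ : g →ₗ[k] g) = expEnd k g (LieAlgebra.ad k g n)}

/-- A Cartan subspace of `g_1`: a commutative subspace consisting of semisimple elements,
maximal among subspaces of `g_1` with these two properties. -/
def IsCartanSubspace (m : ℕ) (ζ : k) (θ : g ≃ₗ[k] g) (c : Submodule k g) : Prop :=
  c ≤ gradePiece k g ζ θ (1 : ZMod m) ∧
  (∀ x ∈ c, ∀ y ∈ c, ⁅x, y⁆ = 0) ∧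
  (∀ x ∈ c, (LieAlgebra.ad k g x).IsSemisimple) ∧
  ∀ c' : Submodule k g, c' ≤ gradePiece k g ζ θ (1 : ZMod m) →
    (∀ x ∈ c', ∀ y ∈ c', ⁅x, y⁆ = 0) → (∀ x ∈ c', (LieAlgebra.ad k g x).IsSemisimple) →
    c ≤ c' → c = c'

/-- Polynomial functions on `g`: functions arising from the symmetric algebra of `g*`. -/
def IsPolyFun (F : g → k) : Prop :=
  ∃ p : MvPolynomial (Module.Dual k g) k, ∀ x, F x = MvPolynomial.eval (fun φ => φ x) p

/-- The number `k_i = Σ_{c ∈ ℤ, c ≡ i (mod m)} dim {v ∈ z(e) : ⁅h, v⁆ = 2c • v}`. -/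
noncomputable def kNum (m : ℕ) (e h : g) (i : ZMod m) : ℕ :=
  ∑ᶠ c : ℤ, if ((c : ZMod m) = i) then
    Module.finrank k ↥(zc k g e ⊓ Module.End.eigenspace (LieAlgebra.ad k g h) (2 * (c : k)))
  else 0


section Helpers

variable {k g}

/-- An `h`-eigenvector `y` of weight `n + 2 > 0` with `⁅e, ⁅f, y⁆⁆ = 0` vanishes. -/
lemma aux_weight (e h f : g)
    (hhe : ⁅h, e⁆ = (2 : k) • e) (hef : ⁅e, f⁆ = h) (y : g) (n : ℕ)
    (hy : ⁅h, y⁆ = ((n : k) + 2) • y) (hey : ⁅e, ⁅f, y⁆⁆ = 0) : y = 0 := by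
  by_contra hne
  have hH : ∀ j : ℕ, ⁅h, ((ad k g e) ^ j) y⁆ = ((n : k) + 2 + 2 * j) • ((ad k g e) ^ j) y := by
    intro j
    induction j with
    | zero => simpa using hy
    | succ j ih =>
      rw [pow_succ', Module.End.mul_apply, ad_apply, leibniz_lie h, hhe, smul_lie, ih, lie_smul,
        ← add_smul]
      congr 1
      push_cast
      ring
  have hB : ∀ j : ℕ, ⁅f, ((ad k g e) ^ (j + 1)) y⁆
      = (-(((j : k) + 1) * ((n : k) + 2 + j))) • ((ad k g e) ^ j) y := by
    have key : ∀ z : g, ⁅f, ⁅e, z⁆⁆ = ⁅e, ⁅f, z⁆⁆ - ⁅h, z⁆ := by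
      intro z
      rw [leibniz_lie e f z, hef]
      abel
    intro j
    induction j with
    | zero =>
      simp only [zero_add, pow_one, ad_apply, pow_zero, Module.End.one_apply]
      rw [key, hey, hy, zero_sub, ← neg_smul]
      simp
    | succ j ih =>
      rw [pow_succ' _ (j + 1), Module.End.mul_apply, ad_apply, key, ih, hH, lie_smul,
        ← ad_apply k g e, ← Module.End.mul_apply, ← pow_succ', ← sub_smul]
      congr 1
      push_cast
      ring
  have hall : ∀ j : ℕ, ((ad k g e) ^ j) y ≠ 0 := by
    intro j
    induction j with
    | zero => simpa using hne
    | succ j ih =>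
      intro h0
      have := hB j
      rw [h0, lie_zero, eq_comm, smul_eq_zero_iff_left ih, neg_eq_zero, mul_eq_zero] at this
      rcases this with h1 | h1
      · exact Nat.cast_add_one_ne_zero j h1
      · have : ((n + 2 + j : ℕ) : k) = 0 := by push_cast; exact h1
        rw [Nat.cast_eq_zero] at this
        omega
  have hinj : Function.Injective (fun j : ℕ => (n : k) + 2 + 2 * j) := fun a b hab ↦ by
    simpa using hab
  have hli := (ad k g h).eigenvectors_linearIndependent' (fun j : ℕ => (n : k) + 2 + 2 * j) hinj
    (fun j => ((ad k g e) ^ j) y)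
    (fun j => ⟨by rw [Module.End.mem_eigenspace_iff, ad_apply]; exact hH j, hall j⟩)
  have hfin : Finite ℕ := hli.finite
  exact not_finite ℕ

/-- `z(e) ∩ [f, g] = 0`. -/
lemma aux_disjoint (e h f : g)
    (hhe : ⁅h, e⁆ = (2 : k) • e) (hhf : ⁅h, f⁆ = -((2 : k) • f)) (hef : ⁅e, f⁆ = h) :
    LinearMap.ker (ad k g e) ⊓ LinearMap.range (ad k g f) = ⊥ := by
  by_cases h0 : h = 0
  · have hf : f = 0 := by
      rw [h0, zero_lie, eq_comm, neg_eq_zero, smul_eq_zero] at hhf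
      simpa using hhf
    simp [hf]
  have t : IsSl2Triple h e f := ⟨h0, hef, by rw [hhe, two_smul, two_nsmul],
    by rw [hhf, two_smul, two_nsmul]⟩
  by_contra hW
  set W := LinearMap.ker (ad k g e) ⊓ LinearMap.range (ad k g f) with hWdef
  have hst : ∀ x ∈ W, ad k g h x ∈ W := by
    rintro x ⟨hx1, ⟨y, rfl⟩⟩
    refine ⟨?_, ?_⟩
    · rw [SetLike.mem_coe, LinearMap.mem_ker] at hx1 ⊢
      rw [ad_apply] at hx1
      rw [ad_apply, ad_apply, leibniz_lie e h, hx1, lie_zero, add_zero, ← lie_skew e h, hhe, neg_lie,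
        smul_lie, hx1]
      simp
    · refine ⟨⁅h, y⁆ - (2 : k) • y, ?_⟩
      simp only [ad_apply]
      rw [leibniz_lie h, hhf, lie_sub, lie_smul, neg_lie, smul_lie]
      abel
  haveI : Nontrivial W := Submodule.nontrivial_iff_ne_bot.mpr hW
  obtain ⟨μ, hμ⟩ := Module.End.exists_eigenvalue ((ad k g h).restrict hst)
  obtain ⟨⟨x, hxW⟩, hx⟩ := hμ.exists_hasEigenvector
  have hxne : x ≠ 0 := fun h => hx.2 (by simpa using h)
  have hxh : ⁅h, x⁆ = μ • x := by
    have := congrArg Subtype.val hx.apply_eq_smul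
    simpa using this
  have hxe : ⁅e, x⁆ = 0 := by simpa using hxW.1
  obtain ⟨y, hyx⟩ := hxW.2
  rw [ad_apply] at hyx
  obtain ⟨n, rfl⟩ := IsSl2Triple.HasPrimitiveVectorWith.exists_nat (t := t) (m := x) (μ := μ)
    ⟨hxne, hxh, hxe⟩
  -- `ad h - (n + 2)` is bijective on `ker ad f`
  set T : Module.End k g := ad k g h - ((n : k) + 2) • 1 with hT
  have hTapp : ∀ z, T z = ⁅h, z⁆ - ((n : k) + 2) • z := fun z => by simp [hT]
  have hTst : ∀ z ∈ LinearMap.ker (ad k g f), T z ∈ LinearMap.ker (ad k g f) := by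
    intro z hz
    rw [LinearMap.mem_ker, ad_apply] at hz ⊢
    rw [hTapp, lie_sub, lie_smul, hz, leibniz_lie f h, hz, ← lie_skew f h, hhf]
    simp [hz]
  have hTinj : Function.Injective (T.restrict hTst) := by
    rw [← LinearMap.ker_eq_bot, LinearMap.ker_eq_bot']
    rintro ⟨z, hz⟩ hz0
    have hz1 : T z = 0 := by simpa using congrArg Subtype.val hz0
    rw [hTapp, sub_eq_zero] at hz1
    by_contra hzne
    have hzne' : z ≠ 0 := fun h => hzne (by simpa using h)
    obtain ⟨l, hl⟩ := IsSl2Triple.HasPrimitiveVectorWith.exists_nat (t := t.symm) (m := z)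
      (μ := -((n : k) + 2)) ⟨hzne', by rw [neg_lie, hz1, neg_smul], by simpa using hz⟩
    have : ((l + n + 2 : ℕ) : k) = 0 := by push_cast; rw [← hl]; ring
    rw [Nat.cast_eq_zero] at this
    omega
  have hTsurj := LinearMap.injective_iff_surjective.mp hTinj
  have hz : T y ∈ LinearMap.ker (ad k g f) := by
    rw [LinearMap.mem_ker, ad_apply, hTapp, lie_sub, lie_smul, leibniz_lie f h, hyx, hxh,
      ← lie_skew f h, hhf, neg_neg, smul_lie, hyx, ← add_smul, sub_eq_zero, add_comm]
  obtain ⟨⟨w, hw⟩, hwy⟩ := hTsurj ⟨T y, hz⟩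
  have hwy' : T w = T y := by simpa using congrArg Subtype.val hwy
  have hfw : ⁅f, w⁆ = 0 := by simpa using hw
  have hy0 : y - w = 0 := by
    refine aux_weight (k := k) e h f hhe hef (y - w) n ?_ ?_
    · rw [← sub_eq_zero, ← hTapp, map_sub, hwy', sub_self]
    · rw [lie_sub, hyx, hfw, sub_zero, hxe]
  apply hxne
  rw [← hyx, sub_eq_zero.mp hy0, hfw]

/-- The pairing of `z(e)_a` with `z(f)_{a⁻¹}` is non-degenerate on the left. -/
lemma aux_le (m : ℕ) (hm : 1 ≤ m)
    (θ : g ≃ₗ[k] g) (hθb : ∀ x y : g, θ ⁅x, y⁆ = ⁅θ x, θ y⁆) (hθm : θ ^ m = 1)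
    (e h f : g)
    (hhe : ⁅h, e⁆ = (2 : k) • e) (hhf : ⁅h, f⁆ = -((2 : k) • f)) (hef : ⁅e, f⁆ = h)
    (c : k) (hc : c ≠ 0) (hθf : θ f = c • f) (a : k) (ha : a ^ m = 1) :
    Module.finrank k ↥(zc k g e ⊓ Module.End.eigenspace (θ : g →ₗ[k] g) a)
      ≤ Module.finrank k ↥(zc k g f ⊓ Module.End.eigenspace (θ : g →ₗ[k] g) a⁻¹) := by
  have ha0 : a ≠ 0 := by
    rintro rfl
    rw [zero_pow (by omega)] at ha
    exact zero_ne_one ha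
  let Θ : g ≃ₗ⁅k⁆ g := { θ with map_lie' := fun {x y} => hθb x y }
  have hκ : ∀ x y, killingForm k g (θ x) (θ y) = killingForm k g x y :=
    fun x y => LieAlgebra.killingForm_of_equiv_apply Θ x y
  set P := zc k g e ⊓ Module.End.eigenspace (θ : g →ₗ[k] g) a
  set Q := zc k g f ⊓ Module.End.eigenspace (θ : g →ₗ[k] g) a⁻¹ with hQ
  let Ψ : P →ₗ[k] Module.Dual k Q := (Q.subtype.dualMap) ∘ₗ (killingForm k g) ∘ₗ P.subtype
  have hΨ : Function.Injective Ψ := by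
    rw [← LinearMap.ker_eq_bot, LinearMap.ker_eq_bot']
    rintro ⟨x, hxe, hxa⟩ hx
    have hxQ : ∀ y ∈ Q, killingForm k g x y = 0 := fun y hy => by
      simpa [Ψ] using LinearMap.congr_fun hx ⟨y, hy⟩
    have hθx : θ x = a • x := by simpa [Module.End.mem_eigenspace_iff] using hxa
    have hxf : ∀ y, ⁅f, y⁆ = 0 → killingForm k g x y = 0 := by
      intro y hy
      have hpow : ∀ j : ℕ, (θ ^ j) x = a ^ j • x := by
        intro j
        induction j with
        | zero => simp
        | succ j ih => rw [pow_succ', LinearEquiv.mul_apply, ih, map_smul, hθx, smul_smul, pow_succ]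
      have hinv : ∀ j : ℕ, killingForm k g ((θ ^ j) x) ((θ ^ j) y) = killingForm k g x y := by
        intro j
        induction j with
        | zero => simp
        | succ j ih => rw [pow_succ', LinearEquiv.mul_apply, LinearEquiv.mul_apply, hκ, ih]
      have hfj : ∀ j : ℕ, ⁅f, (θ ^ j) y⁆ = 0 := by
        intro j
        induction j with
        | zero => simpa using hy
        | succ j ih =>
          have h1 := hθb f ((θ ^ j) y)
          rw [ih, map_zero, hθf, smul_lie, eq_comm, smul_eq_zero] at h1
          rw [pow_succ', LinearEquiv.mul_apply]
          exact h1.resolve_left hc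
      let w := ∑ j ∈ Finset.range m, a ^ j • (θ ^ j) y
      have hwQ : w ∈ Q := by
        refine ⟨?_, ?_⟩
        · simp [zc, w, lie_sum, hfj]
        · rw [SetLike.mem_coe, Module.End.mem_eigenspace_iff]
          have h1 : a • θ w = w := by
            have h2 : a • θ w = ∑ j ∈ Finset.range m, a ^ (j + 1) • (θ ^ (j + 1)) y := by
              simp only [w, map_sum, Finset.smul_sum, map_smul, smul_smul]
              refine Finset.sum_congr rfl fun j _ => ?_
              rw [pow_succ' θ, LinearEquiv.mul_apply, pow_succ']
            have h3 := Finset.sum_range_succ (fun j => a ^ j • (θ ^ j) y) m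
            rw [Finset.sum_range_succ', ha, hθm] at h3
            simp only [pow_zero] at h3
            rw [h2]
            exact add_right_cancel h3
          calc θ w = a⁻¹ • (a • θ w) := by rw [smul_smul, inv_mul_cancel₀ ha0, one_smul]
            _ = a⁻¹ • w := by rw [h1]
      have h4 := hxQ w hwQ
      have h5 : killingForm k g x w = m • killingForm k g x y := by
        simp only [w, map_sum, map_smul]
        rw [Finset.sum_congr rfl (g := fun _ => killingForm k g x y), Finset.sum_const,
          Finset.card_range]
        intro j _
        rw [← hinv j, hpow]
        simp
      rw [h5, nsmul_eq_mul, mul_eq_zero, Nat.cast_eq_zero] at h4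
      exact h4.resolve_left (by omega)
    have hxr : x ∈ LinearMap.range (ad k g f) := by
      have hnd := LieAlgebra.IsKilling.killingForm_nondegenerate k g
      have hrefl : (killingForm k g).IsRefl := (LieModule.traceForm_isSymm k g g).isRefl
      rw [← LinearMap.BilinForm.orthogonal_orthogonal hnd hrefl (LinearMap.range (ad k g f))]
      intro y hy
      refine hrefl _ _ (hxf y ?_)
      rw [LinearMap.BilinForm.mem_orthogonal_iff] at hy
      apply (LinearMap.ker_eq_bot'.mp (LieAlgebra.IsKilling.ker_killingForm_eq_bot k g))
      ext z
      have h1 := hy ⁅f, z⁆ ⟨z, rfl⟩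
      have h2 := hrefl _ _ h1
      have h3 := LieModule.traceForm_apply_lie_apply k g g y f z
      have h4 : killingForm k g ⁅y, f⁆ z = 0 := h3.trans h2
      rw [← lie_skew, map_neg, LinearMap.neg_apply, h4]
      simp
    have hx0 : x ∈ (⊥ : Submodule k g) := by
      rw [← aux_disjoint (k := k) e h f hhe hhf hef]
      exact ⟨hxe, hxr⟩
    exact Subtype.ext ((Submodule.mem_bot k).mp hx0)
  calc Module.finrank k P ≤ Module.finrank k (Module.Dual k Q) :=
        LinearMap.finrank_le_finrank_of_injective hΨ
    _ = Module.finrank k Q := Subspace.dual_finrank_eq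

end Helpers

theorem dim_centralizer_e_eq_f
    (m : ℕ) (hm : 1 ≤ m) (ζ : k) (hζ : IsPrimitiveRoot ζ m)
    (θ : g ≃ₗ[k] g) (hθb : ∀ x y : g, θ ⁅x, y⁆ = ⁅θ x, θ y⁆) (hθm : θ ^ m = 1)
    (e h f : g)
    (hhe : ⁅h, e⁆ = (2 : k) • e) (hhf : ⁅h, f⁆ = -((2 : k) • f)) (hef : ⁅e, f⁆ = h)
    (hθe : θ e = ζ • e) (hθh : θ h = h) (hθf : θ f = ζ⁻¹ • f)
    (i : ZMod m) :
    Module.finrank k ↥(zc k g e ⊓ gradePiece k g ζ θ i)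
      = Module.finrank k ↥(zc k g f ⊓ gradePiece k g ζ θ (-i)) := by
  haveI : NeZero m := ⟨by omega⟩
  have hζ0 : ζ ≠ 0 := hζ.ne_zero (by omega)
  have ha : (ζ ^ i.val) ^ m = 1 := by rw [← pow_mul, mul_comm, pow_mul, hζ.pow_eq_one, one_pow]
  have hneg : ζ ^ (-i).val = (ζ ^ i.val)⁻¹ := by
    apply eq_inv_of_mul_eq_one_left
    rw [← pow_add, hζ.pow_eq_one_iff_dvd, ← ZMod.natCast_eq_zero_iff]
    simp
  unfold gradePiece
  rw [hneg]
  refine le_antisymm (aux_le m hm θ hθb hθm e h f hhe hhf hef _ (inv_ne_zero hζ0) hθf _ ha) ?_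
  have := aux_le m hm θ hθb hθm f (-h) e (k := k) (by rw [neg_lie, hhf, neg_neg])
    (by rw [neg_lie, hhe]) (by rw [← lie_skew, hef]) ζ hζ0 hθe (ζ ^ i.val)⁻¹
    (by rw [inv_pow, ha, inv_one])
  rwa [inv_inv] at this
end

section
/- Suppose θ is inner and N-regular, and let (e,h,f) be a regular θ-adapted sl2-triple. Then for every i ∈ ℤ/mℤ, dim (z(e) ∩ g_i) = k_i; equivalently, the eigenvalues of θ on z(e) are ζ^{m_1}, …, ζ^{m_l}, where m_1, …, m_l are the exponents of g. -/
open LieAlgebra Module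

variable (k : Type*) [Field k] [IsAlgClosed k] [CharZero k]
variable (g : Type*) [LieRing g] [LieAlgebra k g] [FiniteDimensional k g]
  [LieAlgebra.IsSemisimple k g]

section PartA
variable {F : Type*} [Field F] [CharZero F] {V : Type*} [AddCommGroup V] [Module F V]
  [FiniteDimensional F V]

omit [FiniteDimensional F V] [CharZero F] in
theorem E_pow_shift (H f : Module.End F V) (r : F) (hf : H * f = f * H + r • f) (n : ℕ) :
    H * f ^ n = f ^ n * H + (n * r : F) • f ^ n := by
  induction n with
  | zero => simp
  | succ n ih =>
    rw [pow_succ, ← mul_assoc, ih, add_mul, mul_assoc, hf, mul_add]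
    simp only [mul_smul_comm, smul_mul_assoc, mul_assoc]
    push_cast
    rw [add_assoc, ← add_smul]
    congr 2
    ring

theorem nilp_of_shift (H f : Module.End F V) (r : F) (hr : r ≠ 0)
    (hf : H * f = f * H + r • f) : ∃ N, f ^ N = 0 := by
  by_contra! hne
  let Ad : Module.End F (Module.End F V) := LinearMap.mulLeft F H - LinearMap.mulRight F H
  have hinj : Function.Injective (fun n : ℕ => (n * r : F)) := by
    intro a b hab
    simpa [hr] using hab
  have h1 : ∀ n : ℕ, Ad.HasEigenvector (n * r) (f ^ n) := by
    intro n
    refine ⟨?_, hne n⟩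
    rw [Module.End.mem_eigenspace_iff]
    simp [Ad, E_pow_shift H f r hf n]
  have h2 := Module.End.eigenvectors_linearIndependent' Ad (fun n : ℕ => (n * r : F)) hinj _ h1
  have := h2.finite
  exact not_finite ℕ

variable (E H Fm : Module.End F V) (hHE : H * E = E * H + (2 : F) • E)
    (hHF : H * Fm = Fm * H + (-2 : F) • Fm) (hEF : E * Fm = Fm * E + H)

include hHF hEF in
omit [FiniteDimensional F V] [CharZero F] in
theorem sl2_EFpow (v : V) (hv : E v = 0) (n : ℕ) :
    E ((Fm ^ (n + 1)) v) = ((n : F) + 1) • (Fm ^ n) (H v - (n : F) • v) := by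
  induction n with
  | zero =>
    have := LinearMap.congr_fun hEF v
    simp at this
    simp [this, hv]
  | succ n ih =>
    have h1 := LinearMap.congr_fun hEF ((Fm ^ (n + 1)) v)
    have h2 := LinearMap.congr_fun (E_pow_shift H Fm (-2) hHF (n + 1)) v
    simp only [Module.End.mul_apply, LinearMap.add_apply, LinearMap.smul_apply] at h1 h2
    rw [pow_succ' Fm (n + 1), Module.End.mul_apply, h1, ih, h2]
    rw [map_smul, ← Module.End.mul_apply Fm, ← pow_succ']
    simp only [map_sub, map_smul]
    push_cast
    module

/-- the falling product `H (H-1) ... (H-n+1)` -/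
noncomputable def hprod (H : Module.End F V) (n : ℕ) : Module.End F V :=
  Polynomial.aeval H (descPochhammer F n)

include hHE in
omit [FiniteDimensional F V] [CharZero F] in
theorem sl2_kerE_H (v : V) (hv : E v = 0) : E (H v) = 0 := by
  have := LinearMap.congr_fun hHE v
  simp [hv] at this
  exact this.symm

include hHE hHF hEF in
omit [FiniteDimensional F V] [CharZero F] in
theorem sl2_EnFn (n : ℕ) (v : V) (hv : E v = 0) :
    (E ^ n) ((Fm ^ n) v) = (n.factorial : F) • (Polynomial.aeval H (descPochhammer F n)) v := by
  induction n generalizing v with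
  | zero => simp
  | succ n ih =>
    rw [pow_succ, Module.End.mul_apply, sl2_EFpow E H Fm hHF hEF v hv, map_smul, ih]
    · rw [descPochhammer_succ_right, smul_smul, Nat.factorial_succ]
      simp only [map_mul, map_sub, map_smul, Polynomial.aeval_X, map_natCast, Module.End.mul_apply,
        LinearMap.sub_apply, Module.End.natCast_apply, Nat.cast_smul_eq_nsmul, Nat.cast_mul,
        map_nsmul, Nat.cast_add, Nat.cast_one, mul_comm]
    · simp [hv, sl2_kerE_H E H hHE v hv]

include hHE hHF hEF in
theorem sl2_aeval_ker : ∃ n : ℕ, ∀ v, E v = 0 →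
    (Polynomial.aeval H (descPochhammer F n)) v = 0 := by
  obtain ⟨N, hN⟩ := nilp_of_shift H Fm (-2) (by norm_num) hHF
  refine ⟨N, fun v hv => ?_⟩
  have := sl2_EnFn E H Fm hHE hHF hEF N v hv
  rw [hN] at this
  simpa [Nat.factorial_ne_zero] using this.symm

include hHE hHF hEF in
/-- eigenvalue of a primitive vector is natural -/
theorem sl2_prim_nat (v : V) (hv : E v = 0) (hv0 : v ≠ 0) (c : F) (hc : H v = c • v) :
    ∃ n : ℕ, c = n := by
  obtain ⟨N, hN⟩ := sl2_aeval_ker E H Fm hHE hHF hEF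
  have h1 := hN v hv
  have h2 : H.HasEigenvector c v := ⟨Module.End.mem_eigenspace_iff.2 hc, hv0⟩
  rw [Module.End.aeval_apply_of_hasEigenvector h2] at h1
  have h3 : (descPochhammer F N).eval c = 0 := by simpa [hv0] using h1
  clear h1 hN
  induction N with
  | zero => simp at h3
  | succ N ih =>
    rw [descPochhammer_succ_right] at h3
    simp only [Polynomial.eval_mul, Polynomial.eval_sub, Polynomial.eval_X,
      Polynomial.eval_natCast, mul_eq_zero] at h3
    rcases h3 with h3 | h3
    · exact ih h3
    · exact ⟨N, sub_eq_zero.1 h3⟩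

include hHE hHF hEF in
theorem sl2_eig_int (v : V) (hv0 : v ≠ 0) (c : F) (hc : H v = c • v) :
    ∃ n : ℤ, c = n := by
  obtain ⟨N, hN⟩ := nilp_of_shift H E 2 (by norm_num) hHE
  have hex : ∃ n, (E ^ n) v = 0 := ⟨N, by simp [hN]⟩
  obtain ⟨n, hn1, hn2⟩ := Nat.exists_not_and_succ_of_not_zero_of_exists
    (p := fun n => (E ^ n) v = 0) (by simpa using hv0) hex
  have h2 := LinearMap.congr_fun (E_pow_shift H E 2 hHE n) v
  simp only [Module.End.mul_apply, LinearMap.add_apply, LinearMap.smul_apply, hc, map_smul] at h2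
  rw [← add_smul] at h2
  obtain ⟨j, hj⟩ := sl2_prim_nat E H Fm hHE hHF hEF _
    (by rw [← Module.End.mul_apply, ← pow_succ']; exact hn2) hn1 _ h2
  refine ⟨j - n * 2, ?_⟩
  push_cast
  rw [← hj]; ring

include hHF hEF in
omit [FiniteDimensional F V] in
theorem sl2_Finj (v : V) (hv : E v = 0) (n : ℕ) (hn : H v = (n : F) • v) (j : ℕ) (hj : j ≤ n)
    (hF : (Fm ^ j) v = 0) : v = 0 := by
  induction j with
  | zero => simpa using hF
  | succ j ih =>
    apply ih (by omega)
    have := sl2_EFpow E H Fm hHF hEF v hv j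
    rw [hF, hn, ← sub_smul, map_smul, smul_smul, map_zero, eq_comm, smul_eq_zero] at this
    refine this.resolve_left ?_
    refine mul_ne_zero (by exact_mod_cast Nat.succ_ne_zero j) ?_
    rw [sub_ne_zero]
    exact_mod_cast (by omega : n ≠ j)

omit [CharZero F] [FiniteDimensional F V] in
theorem mem_sup_eig_of_aeval (H : Module.End F V) [CharZero F] (N : ℕ) (P : Submodule F V)
    (hP : ∀ v ∈ P, H v ∈ P)
    (v : V) (hv : v ∈ P) (h : (Polynomial.aeval H (descPochhammer F N)) v = 0) :
    v ∈ ⨆ n : ℕ, P ⊓ H.eigenspace (n : F) := by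
  induction N generalizing v with
  | zero => simp at h; simp [h]
  | succ N ih =>
    -- `v = w + u` with `w = (H - N) v` scaled
    have hc0 : (descPochhammer F N).eval (N : F) ≠ 0 := by
      rw [descPochhammer_eval_eq_descFactorial]
      simp
    have hinv : ∀ p : Polynomial F, ∀ w ∈ P, (Polynomial.aeval H p) w ∈ P := by
      intro p w hw
      induction p using Polynomial.induction_on' with
      | add p q hp hq => simpa using P.add_mem hp hq
      | monomial n a =>
        simp only [Polynomial.aeval_monomial, Module.End.mul_apply]
        have : ∀ n, (H ^ n) w ∈ P := by
          intro n
          induction n with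
          | zero => simpa
          | succ n ih => rw [pow_succ', Module.End.mul_apply]; exact hP _ ih
        exact P.smul_mem a (this n)
    set p := descPochhammer F N
    have hdvd : (Polynomial.X - Polynomial.C (N : F)) ∣ (p - Polynomial.C (p.eval (N : F))) := by
      rw [Polynomial.dvd_iff_isRoot]; simp
    obtain ⟨q, hq⟩ := hdvd
    set c := p.eval (N : F)
    -- c v = p v - q (X-N) v
    have e1 : v = c⁻¹ • (Polynomial.aeval H p) v
        - c⁻¹ • (Polynomial.aeval H ((Polynomial.X - Polynomial.C (N : F)) * q)) v := by
      rw [← hq]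
      simp only [map_sub, Polynomial.aeval_C, LinearMap.sub_apply, Module.algebraMap_end_apply, smul_sub]
      rw [smul_smul, inv_mul_cancel₀ hc0]; simp
    rw [e1]
    refine Submodule.sub_mem _ (Submodule.smul_mem _ _ ?_) (Submodule.smul_mem _ _ ?_)
    · refine Submodule.mem_iSup_of_mem N ⟨hinv _ _ hv, ?_⟩
      rw [SetLike.mem_coe, Module.End.mem_eigenspace_iff]
      rw [descPochhammer_succ_right, mul_comm] at h
      rw [map_mul, Module.End.mul_apply] at h
      simpa [sub_eq_zero, Nat.cast_smul_eq_nsmul] using h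
    · refine ih _ (hinv _ _ hv) ?_
      rw [← Module.End.mul_apply, ← map_mul]
      have : p * ((Polynomial.X - Polynomial.C (N : F)) * q) = q * descPochhammer F (N + 1) := by
        rw [descPochhammer_succ_right]; simp; ring
      rw [this, map_mul, Module.End.mul_apply, h, map_zero]

include hHE hHF hEF in
theorem sl2_ker_sup : LinearMap.ker E ≤
    ⨆ n : ℕ, LinearMap.ker E ⊓ H.eigenspace (n : F) := by
  obtain ⟨N, hN⟩ := sl2_aeval_ker E H Fm hHE hHF hEF
  intro v hv
  refine mem_sup_eig_of_aeval H N _ ?_ v hv (hN v hv)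
  intro v hv
  exact sl2_kerE_H E H hHE v hv

include hHE in
omit [FiniteDimensional F V] [CharZero F] in
theorem sl2_E_gen (c : F) (v : V) (hv : v ∈ H.maxGenEigenspace c) :
    E v ∈ H.maxGenEigenspace (c + 2) := by
  rw [Module.End.mem_maxGenEigenspace] at hv ⊢
  obtain ⟨n, hn⟩ := hv
  refine ⟨n, ?_⟩
  have h1 : (H - (c + 2) • 1) * E = E * (H - c • 1) := by
    rw [sub_mul, hHE, mul_sub, add_smul]; simp [add_mul]
  have h2 : ∀ n : ℕ, (H - (c + 2) • 1) ^ n * E = E * (H - c • 1) ^ n := by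
    intro n
    induction n with
    | zero => simp
    | succ n ih => rw [pow_succ, mul_assoc, h1, ← mul_assoc, ih, mul_assoc, ← pow_succ]
  rw [← Module.End.mul_apply, h2, Module.End.mul_apply, hn, map_zero]

include hHE in
theorem sl2_dim : Module.finrank F (H.maxGenEigenspace (0 : F)) +
    Module.finrank F (H.maxGenEigenspace (1 : F)) ≤ Module.finrank F (LinearMap.ker E) := by
  classical
  let G : ℕ → Submodule F V := fun n => H.maxGenEigenspace (n : F)
  have hind : iSupIndep G :=
    (Module.End.independent_maxGenEigenspace H).comp (f := fun n : ℕ => (n : F)) Nat.cast_injective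
  let W' : Submodule F V := ⨆ n : ℕ, G (n + 2)
  let U := G 0 ⊔ G 1
  have hU : Module.finrank F U = Module.finrank F (G 0) + Module.finrank F (G 1) := by
    have h := Submodule.finrank_sup_add_finrank_inf_eq (G 0) (G 1)
    have hd : G 0 ⊓ G 1 = ⊥ := (hind.pairwiseDisjoint (by norm_num : (0 : ℕ) ≠ 1)).eq_bot
    rw [hd] at h
    simpa using h
  have hUW : U ⊓ W' = ⊥ := by
    have := hind.disjoint_biSup_biSup (s := {0, 1}) (t := {n | 2 ≤ n})
      (by rw [Set.disjoint_left]; intro a ha hb; simp at ha hb; omega)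
    rw [iSup_pair] at this
    refine (this.mono_right ?_).eq_bot
    refine iSup_le fun n => ?_
    exact le_iSup₂_of_le (n + 2) (by simp) le_rfl
  have hsum := Submodule.finrank_sup_add_finrank_inf_eq U W'
  rw [hUW] at hsum
  have hmap : ∀ n, ∀ v ∈ G n, E v ∈ G (n + 2) := by
    intro n v hv
    have := sl2_E_gen E H hHE _ v hv
    simpa [G] using this
  have hGW : ∀ n, G n ≤ W'.comap E := by
    intro n v hv
    exact Submodule.mem_iSup_of_mem n (hmap n v hv)
  have hle : U ⊔ W' ≤ W'.comap E :=
    sup_le (sup_le (hGW 0) (hGW 1)) (iSup_le fun n => hGW _)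
  have hr := LinearMap.finrank_range_add_finrank_ker (E.domRestrict (U ⊔ W'))
  have h1 : Module.finrank F (LinearMap.range (E.domRestrict (U ⊔ W'))) ≤ Module.finrank F W' := by
    apply Submodule.finrank_mono
    rintro _ ⟨⟨x, hx⟩, rfl⟩
    exact hle hx
  have h2 : Module.finrank F (LinearMap.ker (E.domRestrict (U ⊔ W'))) ≤
      Module.finrank F (LinearMap.ker E) := by
    let φ : LinearMap.ker (E.domRestrict (U ⊔ W')) →ₗ[F] LinearMap.ker E :=
      LinearMap.codRestrict _ ((U ⊔ W').subtype ∘ₗ Submodule.subtype _) (fun x => x.2)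
    apply LinearMap.finrank_le_finrank_of_injective (f := φ)
    intro x y hxy
    have : ((x : ↥(U ⊔ W')) : V) = ((y : ↥(U ⊔ W')) : V) := congrArg (fun z : LinearMap.ker E => (z : V)) hxy
    exact Subtype.ext (Subtype.ext this)
  have h0 : G 0 = H.maxGenEigenspace (0 : F) := by simp [G]
  have h1' : G 1 = H.maxGenEigenspace (1 : F) := by simp [G]
  rw [← h0, ← h1', ← hU]
  simp only [finrank_bot] at hsum
  omega

end PartA

section PartB
open Polynomial in
/-- binomial polynomial -/
noncomputable def binP (F : Type*) [Field F] (j : ℕ) : F[X] :=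
  Polynomial.C ((j.factorial : F)⁻¹) * descPochhammer F j

theorem binP_eval (F : Type*) [Field F] [CharZero F] (j p : ℕ) :
    (binP F j).eval (p : F) = (p.choose j : F) := by
  rw [binP, Polynomial.eval_mul, Polynomial.eval_C, descPochhammer_eval_eq_descFactorial,
    Nat.descFactorial_eq_factorial_mul_choose]
  push_cast
  rw [inv_mul_cancel_left₀]
  exact_mod_cast Nat.factorial_ne_zero j

/-- log coefficients -/
noncomputable def lc (F : Type*) [Field F] (j : ℕ) : F := (binP F j).coeff 1

theorem lc_zero (F : Type*) [Field F] : lc F 0 = 0 := by simp [lc, binP, Polynomial.coeff_one]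
theorem lc_one (F : Type*) [Field F] : lc F 1 = 1 := by simp [lc, binP]

theorem binP_coeff_zero (F : Type*) [Field F] [CharZero F] (j : ℕ) :
    (binP F j).coeff 0 = if j = 0 then 1 else 0 := by
  rw [Polynomial.coeff_zero_eq_eval_zero]
  have := binP_eval F j 0
  simp only [Nat.cast_zero] at this
  rw [this]
  cases j <;> simp

theorem Tpow_bracket {F : Type*} [Field F] {V : Type*} [AddCommGroup V] [Module F V]
    (br : V →ₗ[F] V →ₗ[F] V) (T : Module.End F V)
    (hT : ∀ x y, T (br x y) = br (T x) (T y)) (p : ℕ) (x y : V) :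
    (T ^ p) (br x y) = br ((T ^ p) x) ((T ^ p) y) := by
  induction p with
  | zero => simp
  | succ p ih => rw [pow_succ']; simp only [Module.End.mul_apply]; rw [ih, hT]

theorem Tpow_expand {F : Type*} [Field F] {V W : Type*} [AddCommGroup V] [Module F V]
    [AddCommGroup W] [Module F W]
    (A : Module.End F V) (N p : ℕ) (ψ : V →ₗ[F] W) (x : V)
    (h : ∀ j, N ≤ j → ψ ((A ^ j) x) = 0) :
    ψ (((1 + A) ^ p) x) = ∑ j ∈ Finset.range N, (p.choose j : F) • ψ ((A ^ j) x) := by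
  have h1 : ψ (((1 + A) ^ p) x) = ∑ j ∈ Finset.range (p + 1), (p.choose j : F) • ψ ((A ^ j) x) := by
    rw [add_comm, (Commute.one_right A).add_pow]
    simp only [LinearMap.sum_apply, map_sum, one_pow, mul_one]
    refine Finset.sum_congr rfl fun j _ => ?_
    rw [← nsmul_eq_mul', LinearMap.smul_apply, map_nsmul, Nat.cast_smul_eq_nsmul]
  have h2 : ∀ M, p + 1 ≤ M → N ≤ M →
      ∑ j ∈ Finset.range (p + 1), (p.choose j : F) • ψ ((A ^ j) x) =
      ∑ j ∈ Finset.range N, (p.choose j : F) • ψ ((A ^ j) x) := by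
    intro M h1 h2
    have e1 := Finset.sum_subset (Finset.range_subset_range.2 h1)
      (f := fun j => (p.choose j : F) • ψ ((A ^ j) x)) (by
        intro j _ hj
        simp only [Finset.mem_range, not_lt] at hj
        rw [Nat.choose_eq_zero_of_lt (by omega)]; simp)
    have e2 := Finset.sum_subset (Finset.range_subset_range.2 h2)
      (f := fun j => (p.choose j : F) • ψ ((A ^ j) x)) (by
        intro j _ hj
        simp only [Finset.mem_range, not_lt] at hj
        rw [h j hj]; simp)
    rw [e1, e2]
  rw [h1, h2 (p + 1 + N) (by omega) (by omega)]

theorem log_deriv {F : Type*} [Field F] [CharZero F] {V : Type*} [AddCommGroup V] [Module F V]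
    (br : V →ₗ[F] V →ₗ[F] V) (A : Module.End F V)
    (hT : ∀ x y, (1 + A) (br x y) = br ((1 + A) x) ((1 + A) y))
    (N : ℕ) (φ : V →ₗ[F] F) (h1 : ∀ j, N ≤ j → ∀ v, φ ((A ^ j) v) = 0)
    (h2 : ∀ j, N ≤ j → ∀ v w, φ (br ((A ^ j) v) w) = 0)
    (h3 : ∀ j, N ≤ j → ∀ v w, φ (br v ((A ^ j) w)) = 0) (x y : V) :
    φ ((∑ j ∈ Finset.range N, lc F j • A ^ j) (br x y)) =
      φ (br ((∑ j ∈ Finset.range N, lc F j • A ^ j) x) y) +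
      φ (br x ((∑ j ∈ Finset.range N, lc F j • A ^ j) y)) := by
  let P : Polynomial F := ∑ j ∈ Finset.range N, Polynomial.C (φ ((A ^ j) (br x y))) * binP F j
  let Q : Polynomial F := ∑ i ∈ Finset.range N, ∑ j ∈ Finset.range N,
    Polynomial.C (φ (br ((A ^ i) x) ((A ^ j) y))) * (binP F i * binP F j)
  have hPQ : P = Q := by
    apply Polynomial.eq_of_infinite_eval_eq
    refine Set.Infinite.mono (s := Set.range (fun n : ℕ => (n : F))) ?_
      (Set.infinite_range_of_injective Nat.cast_injective)
    rintro _ ⟨p, rfl⟩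
    simp only [Set.mem_ofPred_eq, P, Q, Polynomial.eval_finsetSum, Polynomial.eval_mul,
      Polynomial.eval_C, binP_eval]
    have e := congrArg φ (Tpow_bracket br (1 + A) hT p x y)
    rw [Tpow_expand A N p φ _ (fun j hj => h1 j hj _)] at e
    have e2 := Tpow_expand A N p (φ ∘ₗ br.flip (((1 + A) ^ p) y)) x
      (fun j hj => by simpa using h2 j hj _ _)
    simp only [LinearMap.comp_apply, LinearMap.flip_apply] at e2
    rw [e2] at e
    simp only [smul_eq_mul] at e
    simp only [mul_comm (φ _)]
    rw [e]
    refine Finset.sum_congr rfl fun i _ => ?_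
    have e3 := Tpow_expand A N p (φ ∘ₗ br ((A ^ i) x)) y
      (fun j hj => by simpa using h3 j hj _ _)
    simp only [LinearMap.comp_apply] at e3
    rw [e3, Finset.mul_sum]
    refine Finset.sum_congr rfl fun j _ => ?_
    simp [mul_assoc]
  have hc := congrArg (fun p => p.coeff 1) hPQ
  rcases Nat.eq_zero_or_pos N with rfl | hN
  · simp
  simp only [P, Q, Polynomial.finsetSum_coeff, Polynomial.coeff_C_mul] at hc
  simp only [Polynomial.mul_coeff_one, binP_coeff_zero, mul_add, Finset.sum_add_distrib,
    mul_ite, ite_mul, mul_zero, zero_mul, one_mul, mul_one, Finset.sum_ite_eq', Finset.mem_range, hN,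
    if_true, pow_zero, Module.End.one_apply] at hc
  simp only [LinearMap.sum_apply, map_sum, LinearMap.smul_apply, map_smul, smul_eq_mul]
  have hc' : ∑ j ∈ Finset.range N, lc F j * φ ((A ^ j) (br x y)) = 
     ∑ j ∈ Finset.range N, lc F j * φ (br x ((A ^ j) y)) +
     ∑ j ∈ Finset.range N, lc F j * φ (br ((A ^ j) x) y) := by
    simp only [lc, mul_comm (Polynomial.coeff _ _)]
    rw [hc]
    congr 1
    rw [Finset.sum_comm]
    simp [hN]
  rw [hc', add_comm]

end PartB

section PartB2
open PowerSeries Matrix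
variable {F : Type*} [Field F] [CharZero F] {ι : Type*} [Fintype ι] [DecidableEq ι]

omit [CharZero F] [DecidableEq ι] [Fintype ι] in
theorem coeff_X_pow_smul (n N : ℕ) (h : n < N) (E : Matrix ι ι F⟦X⟧) (i j : ι) :
    PowerSeries.coeff n (((X : F⟦X⟧) ^ N • E) i j) = 0 := by
  rw [Matrix.smul_apply, smul_eq_mul]
  exact (PowerSeries.X_pow_dvd_iff.1 (Dvd.intro _ rfl)) n h

omit [CharZero F] [DecidableEq ι] [Fintype ι] in
theorem eq_of_cong (P Q : Matrix ι ι F⟦X⟧)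
    (h : ∀ N, ∃ E : Matrix ι ι F⟦X⟧, P = Q + (X : F⟦X⟧) ^ N • E) : P = Q := by
  ext i j n
  obtain ⟨E, hE⟩ := h (n + 1)
  rw [hE, Matrix.add_apply, map_add, coeff_X_pow_smul n (n + 1) (by omega), add_zero]

omit [CharZero F] [DecidableEq ι] [Fintype ι] in
theorem cong_of_coeff (P Q : Matrix ι ι F⟦X⟧) (N : ℕ)
    (h : ∀ n < N, ∀ i j, PowerSeries.coeff n (P i j) = PowerSeries.coeff n (Q i j)) :
    ∃ E : Matrix ι ι F⟦X⟧, P = Q + (X : F⟦X⟧) ^ N • E := by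
  have h1 : ∀ i j, ∃ e : F⟦X⟧, P i j - Q i j = X ^ N * e := by
    intro i j
    have : (X : F⟦X⟧) ^ N ∣ P i j - Q i j := by
      rw [PowerSeries.X_pow_dvd_iff]
      intro n hn
      rw [map_sub, h n hn, sub_self]
    exact this
  choose e he using h1
  refine ⟨Matrix.of e, ?_⟩
  ext1 i j
  simp [← he]

omit [CharZero F] in
theorem exists_series (c : ℕ → F) (A A' : Matrix ι ι F⟦X⟧) (hA : A = (X : F⟦X⟧) • A') :
    ∃ u : Matrix ι ι F⟦X⟧, ∀ N, ∃ E : Matrix ι ι F⟦X⟧,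
      u = ∑ j ∈ Finset.range N, c j • A ^ j + (X : F⟦X⟧) ^ N • E := by
  have hp : ∀ n j, n < j → ∀ a b, PowerSeries.coeff n ((A ^ j) a b) = 0 := by
    intro n j hn a b
    rw [hA, smul_pow]
    exact coeff_X_pow_smul n j hn _ _ _
  refine ⟨Matrix.of fun a b => PowerSeries.mk fun n =>
    ∑ j ∈ Finset.range (n + 1), c j * PowerSeries.coeff n ((A ^ j) a b), fun N => ?_⟩
  apply cong_of_coeff
  intro n hn a b
  simp only [Matrix.of_apply, PowerSeries.coeff_mk, Matrix.sum_apply, map_sum, Matrix.smul_apply,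
    PowerSeries.coeff_smul, smul_eq_mul]
  apply Finset.sum_subset (Finset.range_subset_range.2 hn)
  intro j _ hj
  simp only [Finset.mem_range, not_lt] at hj
  rw [hp n j hj, mul_zero]

omit [CharZero F] in
/-- formal logarithm: `D = A * u` -/
theorem exists_log (A A' : Matrix ι ι F⟦X⟧) (hA : A = (X : F⟦X⟧) • A') :
    ∃ u : Matrix ι ι F⟦X⟧, Commute A u ∧ IsUnit u ∧
      ∀ N, ∃ E : Matrix ι ι F⟦X⟧,
      A * u = ∑ j ∈ Finset.range N, lc F j • A ^ j + (X : F⟦X⟧) ^ N • E := by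
  obtain ⟨u, hu⟩ := exists_series (fun j => lc F (j + 1)) A A' hA
  have hc : Commute A u := by
    apply eq_of_cong
    intro N
    obtain ⟨E, hE⟩ := hu N
    refine ⟨A * E - E * A, ?_⟩
    rw [hE, mul_add, add_mul, Finset.mul_sum, Finset.sum_mul]
    simp only [mul_smul_comm, smul_mul_assoc, smul_sub]
    simp only [← pow_succ, ← pow_succ']
    abel
  refine ⟨u, hc, ?_, ?_⟩
  · rw [Matrix.isUnit_iff_isUnit_det, PowerSeries.isUnit_iff_constantCoeff]
    rw [RingHom.map_det]
    obtain ⟨E, hE⟩ := hu 1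
    have : (PowerSeries.constantCoeff (R := F)).mapMatrix u = 1 := by
      rw [hE]
      ext i j
      simp [lc_one, Matrix.one_apply]
    rw [this]; simp
  · intro N
    rcases N with _ | N
    · exact ⟨A * u, by simp⟩
    obtain ⟨E, hE⟩ := hu N
    refine ⟨A' * E, ?_⟩
    rw [hE, mul_add, Finset.sum_range_succ', Finset.mul_sum, lc_zero]
    simp only [mul_smul_comm, ← pow_succ', zero_smul, add_zero]
    congr 1
    rw [hA, smul_mul_assoc, smul_smul, pow_succ]

/-- structure-constant bracket over power series -/
noncomputable def brPS (C : ι → ι → ι → F) :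
    (ι → F⟦X⟧) →ₗ[F] (ι → F⟦X⟧) →ₗ[F] (ι → F⟦X⟧) :=
  LinearMap.mk₂ F (fun x y l => ∑ i, ∑ j, C i j l • (x i * y j))
    (by intros; ext1 l; simp [add_mul, Finset.sum_add_distrib])
    (by intros; ext1 l; simp only [Pi.smul_apply, Finset.smul_sum, smul_mul_assoc, mul_smul_comm]; exact Finset.sum_congr rfl fun i _ => Finset.sum_congr rfl fun j _ => smul_comm _ _ _)
    (by intros; ext1 l; simp [mul_add, Finset.sum_add_distrib])
    (by intros; ext1 l; simp only [Pi.smul_apply, Finset.smul_sum, smul_mul_assoc, mul_smul_comm]; exact Finset.sum_congr rfl fun i _ => Finset.sum_congr rfl fun j _ => smul_comm _ _ _)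

omit [CharZero F] [DecidableEq ι] in
theorem brPS_apply (C : ι → ι → ι → F) (x y : ι → F⟦X⟧) (l : ι) :
    brPS C x y l = ∑ i, ∑ j, C i j l • (x i * y j) := rfl

omit [CharZero F] [DecidableEq ι] in
theorem brPS_smul_left (C : ι → ι → ι → F) (r : F⟦X⟧) (x y : ι → F⟦X⟧) :
    brPS C (r • x) y = r • brPS C x y := by
  ext1 l
  simp only [brPS_apply, Pi.smul_apply, smul_eq_mul, Finset.mul_sum, mul_assoc, mul_smul_comm]

omit [CharZero F] [DecidableEq ι] in
theorem brPS_smul_right (C : ι → ι → ι → F) (r : F⟦X⟧) (x y : ι → F⟦X⟧) :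
    brPS C x (r • y) = r • brPS C x y := by
  ext1 l
  simp only [brPS_apply, Pi.smul_apply, smul_eq_mul, Finset.mul_sum, mul_left_comm _ r,
    mul_smul_comm]

theorem log_deriv_matrix (C : ι → ι → ι → F) (A A' : Matrix ι ι F⟦X⟧)
    (hA : A = (X : F⟦X⟧) • A')
    (hT : ∀ x y, (1 + A) *ᵥ (brPS C x y) = brPS C ((1 + A) *ᵥ x) ((1 + A) *ᵥ y))
    (D : Matrix ι ι F⟦X⟧)
    (hD : ∀ N, ∃ E : Matrix ι ι F⟦X⟧,
      D = ∑ j ∈ Finset.range N, lc F j • A ^ j + (X : F⟦X⟧) ^ N • E) (x y : ι → F⟦X⟧) :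
    D *ᵥ (brPS C x y) = brPS C (D *ᵥ x) y + brPS C x (D *ᵥ y) := by
  let Ak : Module.End F (ι → F⟦X⟧) := (Matrix.mulVecLin A).restrictScalars F
  have hAk : ∀ j v, (Ak ^ j) v = (A ^ j) *ᵥ v := by
    intro j v
    induction j with
    | zero => simp
    | succ j ih =>
      rw [pow_succ', Module.End.mul_apply, ih, pow_succ', ← Matrix.mulVec_mulVec]
      rfl
  have hS : ∀ N v, (∑ j ∈ Finset.range N, lc F j • Ak ^ j) v =
      (∑ j ∈ Finset.range N, lc F j • A ^ j) *ᵥ v := by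
    intro N v
    simp only [LinearMap.sum_apply, LinearMap.smul_apply, hAk, Matrix.sum_mulVec,
      Matrix.smul_mulVec]
  have hAX : ∀ j v, (A ^ j) *ᵥ v = (X : F⟦X⟧) ^ j • ((A' ^ j) *ᵥ v) := by
    intro j v
    rw [hA, smul_pow, Matrix.smul_mulVec]
  have hz : ∀ n N, n < N → ∀ (v : ι → F⟦X⟧) l, PowerSeries.coeff n (((X : F⟦X⟧) ^ N • v) l) = 0 := by
    intro n N h v l
    rw [Pi.smul_apply, smul_eq_mul]
    exact (PowerSeries.X_pow_dvd_iff.1 (Dvd.intro _ rfl)) n h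
  funext l
  ext n
  obtain ⟨E, hE⟩ := hD (n + 1)
  let φ : (ι → F⟦X⟧) →ₗ[F] F := (PowerSeries.coeff n : F⟦X⟧ →ₗ[F] F) ∘ₗ LinearMap.proj l
  have hφ : ∀ v, φ v = PowerSeries.coeff n (v l) := fun v => rfl
  have key := log_deriv (brPS C) Ak (by
      intro x y
      simpa [Ak, Matrix.add_mulVec] using hT x y) (n + 1) φ
    (by intro j hj v; rw [hAk, hAX, hφ, hz n j (by omega)])
    (by intro j hj v w; rw [hAk, hAX, brPS_smul_left, hφ, hz n j (by omega)])
    (by intro j hj v w; rw [hAk, hAX, brPS_smul_right, hφ, hz n j (by omega)]) x y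
  rw [hS, hS, hS] at key
  rw [hE]
  simp only [Matrix.add_mulVec, Matrix.smul_mulVec, map_add, LinearMap.add_apply, brPS_smul_left,
    brPS_smul_right, Pi.add_apply, hz n (n + 1) (Nat.lt_succ_self n), add_zero]
  exact key

end PartB2

section PartB3
open PowerSeries Matrix
variable {ι : Type*} [Fintype ι] [DecidableEq ι] (b : Module.Basis ι k g)

/-- structure constants -/
noncomputable def sc : ι → ι → ι → k := fun i j l => b.repr ⁅b i, b j⁆ l

omit [IsAlgClosed k] [CharZero k] [FiniteDimensional k g] [LieAlgebra.IsSemisimple k g]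
  [DecidableEq ι] in
theorem repr_lie (x y : g) (l : ι) :
    b.repr ⁅x, y⁆ l = ∑ i, ∑ j, sc k g b i j l * (b.repr x i * b.repr y j) := by
  conv_lhs => rw [← b.sum_repr x, ← b.sum_repr y]
  simp only [sum_lie, lie_sum, smul_lie, lie_smul, map_sum, map_smul,
    Finsupp.coe_finsetSum, Finset.sum_apply, Finsupp.smul_apply, smul_eq_mul, sc]
  simp only [Finset.mul_sum]
  rw [Finset.sum_comm]
  refine Finset.sum_congr rfl fun i _ => Finset.sum_congr rfl fun j _ => by ring

/-- A matrix derivation over power series is an "inner" one. -/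
theorem inner_of_deriv (D : Matrix ι ι k⟦X⟧)
    (hD : ∀ x y, D *ᵥ (brPS (sc k g b) x y) =
      brPS (sc k g b) (D *ᵥ x) y + brPS (sc k g b) x (D *ᵥ y)) :
    ∃ a : ι → k⟦X⟧, D = ∑ i, a i • (LinearMap.toMatrix b b (LieAlgebra.ad k g (b i))).map
      (PowerSeries.C (R := k)) := by
  -- coefficients
  let Dn : ℕ → Matrix ι ι k := fun n => D.map (PowerSeries.coeff n)
  let cv : g → (ι → k⟦X⟧) := fun x i => PowerSeries.C (b.repr x i)
  have hmv : ∀ n x l, PowerSeries.coeff n ((D *ᵥ cv x) l) =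
      b.repr (Matrix.toLin b b (Dn n) x) l := by
    intro n x l
    rw [← LinearMap.toMatrix_mulVec_repr b b, LinearMap.toMatrix_toLin]
    simp [Matrix.mulVec, dotProduct, cv, Dn]
  have hbr : ∀ x y, brPS (sc k g b) (cv x) (cv y) = cv ⁅x, y⁆ := by
    intro x y
    funext l
    simp only [brPS_apply, cv, repr_lie, map_sum, map_mul, PowerSeries.smul_eq_C_mul]
  have hleib : ∀ n x y, Matrix.toLin b b (Dn n) ⁅x, y⁆ =
      ⁅Matrix.toLin b b (Dn n) x, y⁆ + ⁅x, Matrix.toLin b b (Dn n) y⁆ := by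
    intro n x y
    apply b.repr.injective
    ext l
    have h := congrArg (PowerSeries.coeff n) (congrFun (hD (cv x) (cv y)) l)
    rw [hbr, hmv] at h
    rw [h, map_add, Finsupp.add_apply, repr_lie, repr_lie, Pi.add_apply, map_add, brPS_apply,
      brPS_apply]
    simp only [map_sum, PowerSeries.coeff_smul, cv, PowerSeries.coeff_mul_C,
      PowerSeries.coeff_C_mul]
    congr 1 <;> refine Finset.sum_congr rfl fun i _ => Finset.sum_congr rfl fun j _ => ?_
    · rw [← hmv]; rfl
    · rw [← hmv]; rfl
  have hex : ∀ n, ∃ x : g, LieAlgebra.ad k g x = Matrix.toLin b b (Dn n) := by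
    intro n
    let δ : LieDerivation k g g :=
      { toLinearMap := Matrix.toLin b b (Dn n)
        leibniz' := by
          intro x y
          rw [hleib, ← lie_skew y, sub_neg_eq_add, add_comm] }
    obtain ⟨x, hx⟩ := LieDerivation.IsKilling.exists_eq_ad δ
    refine ⟨x, ?_⟩
    ext y
    have := LieDerivation.congr_fun hx y
    have h2 : ⁅x, y⁆ = δ y := by simpa using this
    exact h2
  choose xs hxs using hex
  refine ⟨fun i => PowerSeries.mk fun n => b.repr (xs n) i, ?_⟩
  ext p q n
  have h1 : PowerSeries.coeff n (D p q) = LinearMap.toMatrix b b (LieAlgebra.ad k g (xs n)) p q := by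
    rw [hxs, LinearMap.toMatrix_toLin]; rfl
  rw [h1]
  have h2 : ∀ z : g, LinearMap.toMatrix b b (LieAlgebra.ad k g z) p q =
      ∑ i, b.repr z i * LinearMap.toMatrix b b (LieAlgebra.ad k g (b i)) p q := by
    intro z
    conv_lhs => rw [← b.sum_repr z]
    simp only [map_sum, map_smul, Matrix.sum_apply, Matrix.smul_apply, smul_eq_mul]
  rw [h2, Matrix.sum_apply, map_sum]
  refine Finset.sum_congr rfl fun i _ => ?_
  rw [Matrix.smul_apply, Matrix.map_apply, smul_eq_mul, PowerSeries.coeff_mul_C,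
    PowerSeries.coeff_mk]

theorem charpoly_inner (a : ι → k⟦X⟧) (D : Matrix ι ι k⟦X⟧)
    (hD : D = ∑ i, a i • (LinearMap.toMatrix b b (LieAlgebra.ad k g (b i))).map
      (PowerSeries.C (R := k))) (j : ℕ) (hj : j < LieAlgebra.rank k g) :
    D.charpoly.coeff j = 0 := by
  let M : Matrix ι ι (MvPolynomial ι k) := ∑ i, (MvPolynomial.X i : MvPolynomial ι k) •
    (LinearMap.toMatrix b b (LieAlgebra.ad k g (b i))).map (MvPolynomial.C (σ := ι))
  have hM : M.charpoly.coeff j = 0 := by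
    apply MvPolynomial.funext
    intro t
    rw [map_zero]
    have e1 : (M.map (MvPolynomial.eval t)) =
        LinearMap.toMatrix b b (LieAlgebra.ad k g (∑ i, t i • b i)) := by
      ext p q
      simp [M, Matrix.sum_apply]
    have e2 := Matrix.charpoly_map M (MvPolynomial.eval t)
    have e3 := congrArg (fun p => p.coeff j) e2
    simp only [Polynomial.coeff_map] at e3
    rw [← e3, e1, LinearMap.charpoly_toMatrix]
    apply Polynomial.coeff_eq_zero_of_lt_natTrailingDegree
    exact hj.trans_le (LieAlgebra.rank_le_natTrailingDegree_charpoly_ad k _)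
  have e1 : D = M.map (MvPolynomial.eval₂Hom (PowerSeries.C (R := k)) a) := by
    rw [hD]
    ext1 p q
    simp [M, Matrix.sum_apply]
  rw [e1, Matrix.charpoly_map, Polynomial.coeff_map, hM, map_zero]

end PartB3
section PartC
open Matrix

theorem charpoly_coeff_of_commute {R : Type*} [CommRing R] [IsDomain R] {ι : Type*} [Fintype ι]
    [DecidableEq ι] (P U D : Matrix ι ι R) (hc : Commute P U) (hU : IsUnit U) (hD : D = P * U)
    (r : ℕ) (h : ∀ j < r, D.charpoly.coeff j = 0) : ∀ j < r, P.charpoly.coeff j = 0 := by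
  let K := FractionRing R
  let φ : R →+* K := algebraMap R K
  have hinj : Function.Injective φ := IsFractionRing.injective R K
  let P' : Module.End K (ι → K) := Matrix.toLin' (P.map φ)
  let U' : Module.End K (ι → K) := Matrix.toLin' (U.map φ)
  let D' : Module.End K (ι → K) := Matrix.toLin' (D.map φ)
  have hDPU : D' = P' * U' := by
    simp only [D', P', U', hD, Matrix.map_mul, Matrix.toLin'_mul]; rfl
  have hcomm : Commute P' U' := by
    have h1 : P * U = U * P := hc
    have h2 : (P.map φ) * (U.map φ) = (U.map φ) * (P.map φ) := by
      rw [← Matrix.map_mul, h1, Matrix.map_mul]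
    change P' * U' = U' * P'
    have := congrArg Matrix.toLin' h2
    rwa [Matrix.toLin'_mul, Matrix.toLin'_mul] at this
  have hU' : IsUnit U' := by
    have h1 : IsUnit (φ.mapMatrix U) := hU.map _
    have h2 := h1.map (Matrix.toLinAlgEquiv' (R := K) (n := ι))
    exact h2
  have hle : D'.maxGenEigenspace 0 ≤ P'.maxGenEigenspace 0 := by
    intro x hx
    rw [Module.End.mem_maxGenEigenspace] at hx ⊢
    obtain ⟨n, hn⟩ := hx
    refine ⟨n, ?_⟩
    simp only [zero_smul, sub_zero] at hn ⊢
    rw [hDPU, hcomm.mul_pow, (hcomm.pow_pow n n).eq, Module.End.mul_apply] at hn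
    have hi : Function.Injective (U' ^ n) := by
      exact ((Module.End.isUnit_iff _).1 (hU'.pow n)).1
    exact hi (by rw [hn, map_zero])
  have hfr := Submodule.finrank_mono hle
  rw [LinearMap.finrank_maxGenEigenspace_zero_eq, LinearMap.finrank_maxGenEigenspace_zero_eq] at hfr
  have hcD : D'.charpoly = D.charpoly.map φ := by
    rw [← Matrix.charpoly_map]; simp [D', Matrix.charpoly_toLin']
  have hcP : P'.charpoly = P.charpoly.map φ := by
    rw [← Matrix.charpoly_map]; simp [P', Matrix.charpoly_toLin']
  have h1 : r ≤ D'.charpoly.natTrailingDegree := by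
    apply Polynomial.le_natTrailingDegree
    · exact (LinearMap.charpoly_monic D').ne_zero
    · intro j hj
      rw [hcD, Polynomial.coeff_map, h j hj, map_zero]
  intro j hj
  apply hinj
  rw [map_zero, ← Polynomial.coeff_map, ← hcP]
  exact Polynomial.coeff_eq_zero_of_lt_natTrailingDegree (by omega)

variable {ι : Type*} [Fintype ι] [DecidableEq ι] (b : Module.Basis ι k g)

/-- A polynomial family of automorphisms (up to scaling by `q`) joining `1` to `τ`. -/
structure Fam (M : Matrix ι ι (Polynomial k)) (q : Polynomial k) : Prop where
  q0 : q.eval 0 = 1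
  M0 : M.map (Polynomial.eval 0) = 1
  br : ∀ (s : k) (x y : g), q.eval s • Matrix.toLin b b (M.map (Polynomial.eval s)) ⁅x, y⁆ =
    ⁅Matrix.toLin b b (M.map (Polynomial.eval s)) x, Matrix.toLin b b (M.map (Polynomial.eval s)) y⁆

omit [FiniteDimensional k g] [LieAlgebra.IsSemisimple k g] [IsAlgClosed k] in
theorem Fam.poly {M : Matrix ι ι (Polynomial k)} {q : Polynomial k} (hF : Fam k g b M q)
    (i j l : ι) : q * ∑ p, M l p * Polynomial.C (sc k g b i j p) =
      ∑ p, ∑ r, Polynomial.C (sc k g b p r l) * (M p i * M r j) := by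
  apply Polynomial.funext
  intro s
  have h := congrArg (fun z => b.repr z l) (hF.br s (b i) (b j))
  simp only [repr_lie, map_smul, Finsupp.smul_apply, smul_eq_mul] at h
  have h2 : ∀ z p, b.repr (Matrix.toLin b b (M.map (Polynomial.eval s)) z) p =
      ∑ t, (M p t).eval s * b.repr z t := by
    intro z p
    rw [← LinearMap.toMatrix_mulVec_repr b b, LinearMap.toMatrix_toLin]
    simp [Matrix.mulVec, dotProduct]
  simp only [h2] at h
  simp only [Polynomial.eval_mul, Polynomial.eval_finset_sum, Polynomial.eval_C]
  simpa [Finsupp.single_apply, sc] using h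

theorem Fam.rank_le {M : Matrix ι ι (Polynomial k)} {q : Polynomial k} (hF : Fam k g b M q) :
    LieAlgebra.rank k g ≤ Module.finrank k (Module.End.maxGenEigenspace (Matrix.toLin b b
      (M.map (Polynomial.eval 1))) (q.eval 1)) := by
  let φ : Polynomial k →+* PowerSeries k := Polynomial.coeToPowerSeries.ringHom
  have hφinj : Function.Injective φ := Polynomial.coe_injective k
  have hφC : ∀ c : k, φ (Polynomial.C c) = PowerSeries.C c := fun c => Polynomial.coe_C c
  have hconst : ∀ p : Polynomial k, PowerSeries.constantCoeff (φ p) = p.eval 0 := by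
    intro p
    rw [← Polynomial.coeff_zero_eq_eval_zero]
    change PowerSeries.constantCoeff (p : PowerSeries k) = _
    rw [← PowerSeries.coeff_zero_eq_constantCoeff_apply, Polynomial.coeff_coe]
  have hqu : IsUnit (φ q) := by
    rw [PowerSeries.isUnit_iff_constantCoeff, hconst, hF.q0]; exact isUnit_one
  obtain ⟨w, hw⟩ := hqu.exists_left_inv
  -- w * φ q = 1
  let P0 : Matrix ι ι (Polynomial k) := M - q • (1 : Matrix ι ι (Polynomial k))
  let P : Matrix ι ι (PowerSeries k) := P0.map φ
  have hP : P = M.map φ - φ q • (1 : Matrix ι ι (PowerSeries k)) := by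
    ext1 i j
    simp only [P, P0, Matrix.map_apply, Matrix.sub_apply, Matrix.smul_apply, smul_eq_mul,
      Matrix.one_apply, map_sub, map_mul]
    split_ifs <;> simp
  have hXP : ∀ i j, ∃ c, P i j = PowerSeries.X * c := by
    intro i j
    apply PowerSeries.X_dvd_iff.2
    change PowerSeries.constantCoeff (φ (P0 i j)) = 0
    rw [hconst]
    have h1 : (M i j).eval 0 = (1 : Matrix ι ι k) i j := by rw [← hF.M0]; rfl
    simp only [P0, Matrix.sub_apply, Matrix.smul_apply, smul_eq_mul, Polynomial.eval_sub,
      Polynomial.eval_mul, hF.q0, h1, one_mul, Matrix.one_apply]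
    split_ifs <;> simp
  choose P1 hP1 using hXP
  let A : Matrix ι ι (PowerSeries k) := w • P
  have hA : A = (PowerSeries.X : PowerSeries k) • (w • Matrix.of P1) := by
    ext1 i j
    simp only [A, Matrix.smul_apply, hP1, smul_eq_mul, Matrix.of_apply]
    ring
  have hT : 1 + A = w • M.map φ := by
    simp only [A, hP, smul_sub, smul_smul, hw, one_smul]
    abel
  have hbr : ∀ x y, (1 + A) *ᵥ (brPS (sc k g b) x y) =
      brPS (sc k g b) ((1 + A) *ᵥ x) ((1 + A) *ᵥ y) := by
    intro x y
    rw [hT, Matrix.smul_mulVec, Matrix.smul_mulVec, Matrix.smul_mulVec, brPS_smul_left,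
      brPS_smul_right]
    have key : φ q • (M.map φ *ᵥ brPS (sc k g b) x y) =
        brPS (sc k g b) (M.map φ *ᵥ x) (M.map φ *ᵥ y) := by
      funext l
      have hpoly : ∀ i j, φ q * ∑ p, φ (M l p) * PowerSeries.C (sc k g b i j p) =
          ∑ p, ∑ r, PowerSeries.C (sc k g b p r l) * (φ (M p i) * φ (M r j)) := by
        intro i j
        have := congrArg φ (hF.poly k g b i j l)
        simpa only [map_mul, map_sum, hφC] using this
      have e1 : (φ q • (M.map φ *ᵥ brPS (sc k g b) x y)) l =
          ∑ i, ∑ j, (φ q * ∑ p, φ (M l p) * PowerSeries.C (sc k g b i j p)) * (x i * y j) := by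
        simp only [Pi.smul_apply, smul_eq_mul, Matrix.mulVec, dotProduct, Matrix.map_apply,
          brPS_apply, PowerSeries.smul_eq_C_mul, Finset.mul_sum, Finset.sum_mul]
        rw [Finset.sum_comm]
        refine Finset.sum_congr rfl fun i _ => ?_
        rw [Finset.sum_comm]
        refine Finset.sum_congr rfl fun j _ => Finset.sum_congr rfl fun p _ => by ring
      have e2 : brPS (sc k g b) (M.map φ *ᵥ x) (M.map φ *ᵥ y) l =
          ∑ i, ∑ j, (∑ p, ∑ r, PowerSeries.C (sc k g b p r l) * (φ (M p i) * φ (M r j))) *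
            (x i * y j) := by
        simp only [Matrix.mulVec, dotProduct, Matrix.map_apply,
          brPS_apply, PowerSeries.smul_eq_C_mul, Finset.mul_sum, Finset.sum_mul]
        have s1 : ∀ f : ι → ι → ι → ι → PowerSeries k,
            ∑ p, ∑ r, ∑ j, ∑ i, f p r j i = ∑ i, ∑ j, ∑ p, ∑ r, f p r j i := by
          intro f
          calc ∑ p, ∑ r, ∑ j, ∑ i, f p r j i = ∑ p, ∑ r, ∑ i, ∑ j, f p r j i :=
                Finset.sum_congr rfl fun p _ => Finset.sum_congr rfl fun r _ => Finset.sum_comm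
            _ = ∑ p, ∑ i, ∑ r, ∑ j, f p r j i :=
                Finset.sum_congr rfl fun p _ => Finset.sum_comm
            _ = ∑ i, ∑ p, ∑ r, ∑ j, f p r j i := Finset.sum_comm
            _ = ∑ i, ∑ p, ∑ j, ∑ r, f p r j i :=
                Finset.sum_congr rfl fun p _ => Finset.sum_congr rfl fun r _ => Finset.sum_comm
            _ = ∑ i, ∑ j, ∑ p, ∑ r, f p r j i :=
                Finset.sum_congr rfl fun p _ => Finset.sum_comm
        rw [s1]
        refine Finset.sum_congr rfl fun i _ => Finset.sum_congr rfl fun j _ =>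
          Finset.sum_congr rfl fun p _ => Finset.sum_congr rfl fun r _ => by ring
      rw [e1, e2]
      refine Finset.sum_congr rfl fun i _ => Finset.sum_congr rfl fun j _ => by rw [hpoly]
    rw [← key, smul_smul, smul_smul, mul_assoc, hw, mul_one]
  obtain ⟨u, hu1, hu2, hu3⟩ := exists_log A _ hA
  have hDer := log_deriv_matrix (sc k g b) A _ hA hbr (A * u) hu3
  obtain ⟨a, ha⟩ := inner_of_deriv k g b (A * u) hDer
  have hcoef := charpoly_inner k g b a (A * u) ha
  have hwu : IsUnit w := IsUnit.of_mul_eq_one _ hw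
  have hPA : P = φ q • A := by
    simp only [A, smul_smul]; rw [mul_comm, hw, one_smul]
  have hres := charpoly_coeff_of_commute P (w • u) (A * u) (by
      rw [hPA]; exact (hu1.smul_left _).smul_right _)
    (by
      obtain ⟨w', rfl⟩ := hwu
      exact hu2.smul w')
    (by simp only [A, Matrix.smul_mul, Matrix.mul_smul]) (LieAlgebra.rank k g) hcoef
  have hP0 : ∀ j < LieAlgebra.rank k g, P0.charpoly.coeff j = 0 := by
    intro j hj
    apply hφinj
    rw [map_zero, ← Polynomial.coeff_map, ← Matrix.charpoly_map]
    exact hres j hj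
  let τ : Module.End k g := Matrix.toLin b b (M.map (Polynomial.eval 1))
  have hτ : τ - (q.eval 1) • (1 : Module.End k g) =
      Matrix.toLin b b (P0.map (Polynomial.evalRingHom 1)) := by
    have : P0.map (Polynomial.evalRingHom 1) =
        M.map (Polynomial.eval 1) - (q.eval 1) • (1 : Matrix ι ι k) := by
      ext1 i j
      simp only [P0, Matrix.map_apply, Matrix.sub_apply, Matrix.smul_apply, smul_eq_mul,
        Matrix.one_apply, Polynomial.coe_evalRingHom, Polynomial.eval_sub, Polynomial.eval_mul]
      split_ifs <;> simp
    rw [this, map_sub, map_smul, Matrix.toLin_one]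
    rfl
  rw [Module.End.maxGenEigenspace_eq_maxGenEigenspace_zero]
  change _ ≤ Module.finrank k (Module.End.maxGenEigenspace (τ - (q.eval 1) • (1 : Module.End k g)) 0)
  rw [hτ, LinearMap.finrank_maxGenEigenspace_zero_eq]
  apply Polynomial.le_natTrailingDegree
  · exact (LinearMap.charpoly_monic _).ne_zero
  · intro j hj
    rw [← LinearMap.charpoly_toMatrix _ b, LinearMap.toMatrix_toLin, Matrix.charpoly_map,
      Polynomial.coeff_map, hP0 j hj, map_zero]

end PartC
section PartD
open Matrix

omit [IsAlgClosed k] [LieAlgebra.IsSemisimple k g] in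
theorem expEnd_eq_exp [LieAlgebra ℚ g] (N : Module.End k g) (hN : IsNilpotent N) :
    expEnd k g N = IsNilpotent.exp N := by
  have h0 : N ^ (Module.finrank k g + 1) = 0 := by
    obtain ⟨n, hn⟩ := hN
    have h1 := Module.End.ker_pow_le_ker_pow_finrank N n
    rw [hn] at h1
    have h2 : N ^ (Module.finrank k g) = 0 := by
      ext x
      exact LinearMap.mem_ker.1 (h1 (by simp))
    rw [pow_succ, h2, zero_mul]
  rw [IsNilpotent.exp_eq_sum h0, expEnd]
  refine Finset.sum_congr rfl fun i _ => ?_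
  exact inv_natCast_smul_eq k ℚ _ _

/-- the rational structure -/
noncomputable def ratLie : LieAlgebra ℚ g :=
  letI : Module ℚ g := Module.compHom g (algebraMap ℚ k)
  { lie_smul := fun t x y => by
      change ⁅x, (algebraMap ℚ k t) • y⁆ = (algebraMap ℚ k t) • ⁅x, y⁆
      exact lie_smul _ _ _ }

omit [IsAlgClosed k] [LieAlgebra.IsSemisimple k g] in
theorem expEnd_lie (n : g) (hn : IsNilpotent (LieAlgebra.ad k g n)) (x y : g) :
    expEnd k g (LieAlgebra.ad k g n) ⁅x, y⁆ =
      ⁅expEnd k g (LieAlgebra.ad k g n) x, expEnd k g (LieAlgebra.ad k g n) y⁆ := by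
  letI : LieAlgebra ℚ g := ratLie k g
  have h1 : (LieDerivation.ad k g n).toLinearMap = LieAlgebra.ad k g n := by
    ext z; simp
  have h2 := LieDerivation.exp (LieDerivation.ad k g n) (by rw [h1]; exact hn)
  rw [expEnd_eq_exp k g _ hn, ← h1]
  exact (LieDerivation.exp (LieDerivation.ad k g n) (by rw [h1]; exact hn)).map_lie x y

omit [IsAlgClosed k] [LieAlgebra.IsSemisimple k g] in
theorem expEnd_neg (N : Module.End k g) (hN : IsNilpotent N) :
    expEnd k g (-N) * expEnd k g N = 1 := by
  letI : LieAlgebra ℚ g := ratLie k g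
  rw [expEnd_eq_exp k g _ hN, expEnd_eq_exp k g _ hN.neg]
  exact IsNilpotent.exp_neg_mul_exp_self hN

variable {ι : Type*} [Fintype ι] [DecidableEq ι] (b : Module.Basis ι k g)

omit [CharZero k] [IsAlgClosed k] [LieAlgebra.IsSemisimple k g] [FiniteDimensional k g] in
theorem Fam.mul {M M' : Matrix ι ι (Polynomial k)} {q q' : Polynomial k} (h : Fam k g b M q)
    (h' : Fam k g b M' q') : Fam k g b (M * M') (q * q') := by
  have hmap : ∀ s, (M * M').map (Polynomial.eval s) =
      M.map (Polynomial.eval s) * M'.map (Polynomial.eval s) := fun s =>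
    Matrix.map_mul (f := Polynomial.evalRingHom s)
  refine ⟨by rw [Polynomial.eval_mul, h.q0, h'.q0, one_mul], by rw [hmap, h.M0, h'.M0, one_mul], ?_⟩
  intro s x y
  rw [hmap, Polynomial.eval_mul, Matrix.toLin_mul b b b]
  simp only [LinearMap.comp_apply]
  rw [mul_smul, ← map_smul, h'.br, h.br]

omit [IsAlgClosed k] [LieAlgebra.IsSemisimple k g] in
theorem fam_exp (n : g) (hn : IsNilpotent (LieAlgebra.ad k g n)) :
    ∃ M, Fam k g b M 1 ∧ Matrix.toLin b b (M.map (Polynomial.eval 1)) =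
      expEnd k g (LieAlgebra.ad k g n) := by
  let M : Matrix ι ι (Polynomial k) := ∑ i ∈ Finset.range (Module.finrank k g + 1),
    (Polynomial.C ((i.factorial : k)⁻¹) * Polynomial.X ^ i) •
      (LinearMap.toMatrix b b ((LieAlgebra.ad k g n) ^ i)).map Polynomial.C
  have hM : ∀ s : k, Matrix.toLin b b (M.map (Polynomial.eval s)) =
      expEnd k g (LieAlgebra.ad k g (s • n)) := by
    intro s
    have : M.map (Polynomial.eval s) = LinearMap.toMatrix b b (expEnd k g (LieAlgebra.ad k g (s • n))) := by
      ext1 p q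
      simp only [M, expEnd, Matrix.map_apply, Matrix.sum_apply, map_sum, Matrix.smul_apply,
        smul_eq_mul, map_smul, smul_pow, Polynomial.eval_finset_sum, Polynomial.eval_mul,
        Polynomial.eval_C, Polynomial.eval_pow, Polynomial.eval_X, mul_assoc]
    rw [this, Matrix.toLin_toMatrix]
  refine ⟨M, ⟨by simp, ?_, ?_⟩, by rw [hM, one_smul]⟩
  · have h1 := hM 0
    have h2 : expEnd k g (LieAlgebra.ad k g ((0 : k) • n)) = 1 := by
      rw [zero_smul, map_zero, expEnd, Finset.sum_range_succ']
      simp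
    rw [h2] at h1
    apply (Matrix.toLin b b).injective
    rw [h1, Matrix.toLin_one]; rfl
  · intro s x y
    rw [hM, Polynomial.eval_one, one_smul]
    apply expEnd_lie
    rw [map_smul]
    exact hn.smul s

omit [IsAlgClosed k] [LieAlgebra.IsSemisimple k g] in
theorem fam_inner (θ : g ≃ₗ[k] g) (hθ : θ ∈ IntG k g) :
    ∃ M, Fam k g b M 1 ∧ Matrix.toLin b b (M.map (Polynomial.eval 1)) = (θ : g →ₗ[k] g) := by
  unfold IntG at hθ
  induction hθ using Subgroup.closure_induction'' with
  | mem τ hτ =>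
    obtain ⟨n, hn, h⟩ := hτ
    obtain ⟨M, h1, h2⟩ := fam_exp k g b n hn
    exact ⟨M, h1, by rw [h2, h]⟩
  | inv_mem τ hτ =>
    obtain ⟨n, hn, h⟩ := hτ
    obtain ⟨M, h1, h2⟩ := fam_exp k g b (-n) (by rw [map_neg]; exact hn.neg)
    refine ⟨M, h1, ?_⟩
    rw [h2, map_neg]
    ext x
    have h3 := LinearMap.congr_fun (expEnd_neg k g _ hn) (τ⁻¹ x)
    rw [Module.End.mul_apply, ← h] at h3
    have h4 : τ (τ⁻¹ x) = x := τ.apply_symm_apply x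
    simp only [LinearEquiv.coe_coe, Module.End.one_apply] at h3 ⊢
    rw [h4] at h3
    exact h3
  | one =>
    have h := fam_exp k g b 0 (by simp)
    obtain ⟨M, h1, h2⟩ := h
    refine ⟨M, h1, ?_⟩
    rw [h2, map_zero, expEnd, Finset.sum_range_succ']
    ext x; simp
  | mul x y _ _ hx hy =>
    obtain ⟨M, h1, h2⟩ := hx
    obtain ⟨M', h1', h2'⟩ := hy
    refine ⟨M * M', by simpa using h1.mul k g b h1', ?_⟩
    have : (M * M').map (Polynomial.eval 1) =
      M.map (Polynomial.eval 1) * M'.map (Polynomial.eval 1) :=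
      Matrix.map_mul (f := Polynomial.evalRingHom 1)
    rw [this, Matrix.toLin_mul b b b, h2, h2']
    rfl

end PartD
section PartE
open Matrix

omit [CharZero k] [LieAlgebra.IsSemisimple k g] in
theorem exists_wbasis (h : g)
    (hIntg : ∀ v : g, v ≠ 0 → ∀ c : k, ⁅h, v⁆ = c • v → ∃ n : ℤ, c = n) :
    ∃ (n : ℕ) (b : Module.Basis (Fin n) k g) (w : Fin n → ℤ),
      ∀ i, b i ∈ (LieAlgebra.ad k g h).maxGenEigenspace (w i : k) := by
  classical
  let H : Module.End k g := LieAlgebra.ad k g h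
  have hI := DirectSum.isInternal_submodule_of_iSupIndep_of_iSup_eq_top
    (Module.End.independent_maxGenEigenspace H) (Module.End.iSup_maxGenEigenspace_eq_top H)
  let b0 := hI.collectedBasis (fun μ => Module.finBasis k (H.maxGenEigenspace μ))
  letI := FiniteDimensional.fintypeBasisIndex b0
  have hw : ∀ a : (Σ μ : k, Fin (Module.finrank k (H.maxGenEigenspace μ))), ∃ n : ℤ, a.1 = n := by
    intro a
    have h1 : b0 a ∈ H.maxGenEigenspace a.1 := hI.collectedBasis_mem _ a
    have h2 : b0 a ≠ 0 := b0.ne_zero a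
    have h3 : H.HasUnifEigenvalue a.1 ⊤ := by
      intro hbot
      have h4 : b0 a ∈ H.genEigenspace a.1 ⊤ := h1
      rw [hbot] at h4
      exact h2 ((Submodule.mem_bot k).1 h4)
    have h5 : H.HasEigenvalue a.1 := h3.lt zero_lt_one
    obtain ⟨v, hv⟩ := h5.exists_hasEigenvector
    exact hIntg v hv.2 a.1 hv.apply_eq_smul
  choose w hw using hw
  let eq := Fintype.equivFin (Σ μ : k, Fin (Module.finrank k (H.maxGenEigenspace μ)))
  refine ⟨_, b0.reindex eq, fun i => w (eq.symm i), fun i => ?_⟩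
  rw [← hw, Module.Basis.reindex_apply]
  exact hI.collectedBasis_mem _ _

variable {ι : Type*} [Fintype ι] [DecidableEq ι] (b : Module.Basis ι k g)

omit [IsAlgClosed k] [LieAlgebra.IsSemisimple k g] [DecidableEq ι] [FiniteDimensional k g] in
theorem wbasis_repr (h : g) (w : ι → ℤ)
    (hb : ∀ i, b i ∈ (LieAlgebra.ad k g h).maxGenEigenspace (w i : k)) (c : ℤ) (x : g)
    (hx : x ∈ (LieAlgebra.ad k g h).maxGenEigenspace (c : k)) (j : ι) (hj : w j ≠ c) :
    b.repr x j = 0 := by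
  classical
  let H : Module.End k g := LieAlgebra.ad k g h
  let y := ∑ i ∈ Finset.univ.filter (fun i => w i = c), b.repr x i • b i
  let z := ∑ i ∈ Finset.univ.filter (fun i => ¬ w i = c), b.repr x i • b i
  have hyz : y + z = x := by
    rw [Finset.sum_filter_add_sum_filter_not, b.sum_repr]
  have hy : y ∈ H.maxGenEigenspace (c : k) := by
    refine Submodule.sum_mem _ fun i hi => Submodule.smul_mem _ _ ?_
    rw [← (Finset.mem_filter.1 hi).2]; exact hb i
  have hz : z ∈ ⨆ (μ : k) (_ : μ ≠ (c : k)), H.maxGenEigenspace μ := by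
    refine Submodule.sum_mem _ fun i hi => Submodule.smul_mem _ _ ?_
    have h1 : ((w i : ℤ) : k) ≠ (c : k) := by
      exact_mod_cast (Finset.mem_filter.1 hi).2
    exact Submodule.mem_iSup_of_mem _ (Submodule.mem_iSup_of_mem h1 (hb i))
  have hz2 : z ∈ H.maxGenEigenspace (c : k) := by
    have : z = x - y := by rw [← hyz]; abel
    rw [this]; exact Submodule.sub_mem _ hx hy
  have hz0 : z = 0 :=
    Submodule.disjoint_def.1 (Module.End.independent_maxGenEigenspace H (c : k)) z hz2 hz
  have h2 := congrArg (fun t => b.repr t j) hz0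
  simpa [z, Finsupp.single_apply, hj] using h2

/-- The family `(1+s)^{h}` scaled to be polynomial. -/
noncomputable def rhoM (w : ι → ℤ) (N : ℕ) : Matrix ι ι (Polynomial k) :=
  Matrix.diagonal fun i => (1 + Polynomial.X) ^ (w i + N).toNat

omit [IsAlgClosed k] [CharZero k] [FiniteDimensional k g] [LieAlgebra.IsSemisimple k g] in
theorem rhoM_repr (w : ι → ℤ) (N : ℕ) (s : k) (x : g) (i : ι) :
    b.repr (Matrix.toLin b b ((rhoM k w N).map (Polynomial.eval s)) x) i =
      (1 + s) ^ (w i + N).toNat * b.repr x i := by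
  rw [← LinearMap.toMatrix_mulVec_repr b b, LinearMap.toMatrix_toLin]
  have : (rhoM k w N).map (Polynomial.eval s) =
      Matrix.diagonal fun i => (1 + s) ^ (w i + N).toNat := by
    rw [rhoM, Matrix.diagonal_map (Polynomial.eval_zero)]
    congr 1
    funext i
    simp
  rw [this, Matrix.mulVec_diagonal]

omit [IsAlgClosed k] [LieAlgebra.IsSemisimple k g] [FiniteDimensional k g] in
theorem rhoM_gen (h : g) (w : ι → ℤ)
    (hb : ∀ i, b i ∈ (LieAlgebra.ad k g h).maxGenEigenspace (w i : k)) (N : ℕ) (s : k) (c : ℤ) (x : g)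
    (hx : x ∈ (LieAlgebra.ad k g h).maxGenEigenspace (c : k)) :
    Matrix.toLin b b ((rhoM k w N).map (Polynomial.eval s)) x = (1 + s) ^ (c + N).toNat • x := by
  apply b.repr.injective
  ext i
  rw [rhoM_repr, map_smul, Finsupp.smul_apply, smul_eq_mul]
  by_cases hi : w i = c
  · rw [hi]
  · rw [wbasis_repr k g b h w hb c x hx i hi, mul_zero, mul_zero]

omit [IsAlgClosed k] [LieAlgebra.IsSemisimple k g] [FiniteDimensional k g] in
theorem fam_rho (h : g) (w : ι → ℤ)
    (hb : ∀ i, b i ∈ (LieAlgebra.ad k g h).maxGenEigenspace (w i : k)) (N : ℕ)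
    (hN : ∀ i, 2 * |w i| ≤ N) : Fam k g b (rhoM k w N) ((1 + Polynomial.X) ^ N) := by
  refine ⟨by simp, ?_, ?_⟩
  · rw [rhoM, Matrix.diagonal_map (Polynomial.eval_zero)]
    ext i j
    simp [Matrix.diagonal_apply, Matrix.one_apply]
  · intro s x y
    let R := Matrix.toLin b b ((rhoM k w N).map (Polynomial.eval s))
    let q := ((1 + Polynomial.X : Polynomial k) ^ N).eval s
    have hlin : ((LieModule.toEnd k g g : g →ₗ[k] Module.End k g).compr₂ (q • R)) =
        (LieModule.toEnd k g g : g →ₗ[k] Module.End k g).compl₁₂ R R := by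
      apply LinearMap.ext_basis b b
      intro i j
      simp only [LinearMap.compr₂_apply, LinearMap.compl₁₂_apply]
      change q • R ⁅b i, b j⁆ = ⁅R (b i), R (b j)⁆
      have hij : ⁅b i, b j⁆ ∈ (LieAlgebra.ad k g h).maxGenEigenspace ((w i + w j : ℤ) : k) := by
        push_cast
        exact LieModule.lie_mem_maxGenEigenspace_toEnd (hb i) (hb j)
      simp only [R, q]
      rw [rhoM_gen k g b h w hb N s _ _ hij, rhoM_gen k g b h w hb N s _ _ (hb i),
        rhoM_gen k g b h w hb N s _ _ (hb j), smul_lie, lie_smul, smul_smul, smul_smul]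
      simp only [Polynomial.eval_pow, Polynomial.eval_add, Polynomial.eval_one, Polynomial.eval_X]
      rw [← pow_add, ← pow_add]
      congr 2
      have h1 := hN i
      have h2 := hN j
      have h3 := abs_le.1 (le_refl |w i|)
      have h4 := abs_le.1 (le_refl |w j|)
      omega
    exact LinearMap.congr_fun (LinearMap.congr_fun hlin x) y

/-- The crucial inequality. -/
theorem rank_le_fixed (m : ℕ) (hm : 1 ≤ m)
    (θ : g ≃ₗ[k] g) (hθb : ∀ x y : g, θ ⁅x, y⁆ = ⁅θ x, θ y⁆) (hθm : θ ^ m = 1)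
    (hθinner : θ ∈ IntG k g) (h : g) (hθh : θ h = h)
    (hIntg : ∀ v : g, v ≠ 0 → ∀ c : k, ⁅h, v⁆ = c • v → ∃ n : ℤ, c = n) :
    LieAlgebra.rank k g ≤ Module.finrank k ↥((LieAlgebra.ad k g h).maxGenEigenspace (0 : k) ⊓
      Module.End.eigenspace (θ : g →ₗ[k] g) 1) := by
  obtain ⟨n, b, w, hb⟩ := exists_wbasis k g h hIntg
  let N : ℕ := ∑ i, (2 * |w i|).toNat
  have hN : ∀ i, 2 * |w i| ≤ N := by
    intro i
    have h1 : (2 * |w i|).toNat ≤ N :=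
      Finset.single_le_sum (f := fun i => (2 * |w i|).toNat) (fun _ _ => Nat.zero_le _)
        (Finset.mem_univ i)
    omega
  obtain ⟨M, hM1, hM2⟩ := fam_inner k g b θ hθinner
  have hF := hM1.mul k g b (fam_rho k g b h w hb N hN)
  have hrank := hF.rank_le
  have hmap : (M * rhoM k w N).map (Polynomial.eval 1) =
      M.map (Polynomial.eval 1) * (rhoM k w N).map (Polynomial.eval 1) :=
    Matrix.map_mul (f := Polynomial.evalRingHom 1)
  rw [hmap, Matrix.toLin_mul b b b, hM2] at hrank
  refine hrank.trans (Submodule.finrank_mono ?_)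
  let H : Module.End k g := LieAlgebra.ad k g h
  let T : Module.End k g := (θ : g →ₗ[k] g)
  let R : Module.End k g := Matrix.toLin b b ((rhoM k w N).map (Polynomial.eval 1))
  let S : Module.End k g := T * R
  let μ : k := 2 ^ N
  have hq : ((1 * (1 + Polynomial.X) ^ N : Polynomial k)).eval 1 = μ := by
    simp only [μ, one_mul, Polynomial.eval_pow, Polynomial.eval_add, Polynomial.eval_one,
      Polynomial.eval_X]
    norm_num
  have hμ0 : μ ≠ 0 := pow_ne_zero _ two_ne_zero
  rw [hq]
  change S.maxGenEigenspace μ ≤ _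
  have hTm : T ^ m = 1 := by
    ext x
    have := congrArg (fun τ : g ≃ₗ[k] g => τ x) hθm
    simp only [T]
    have h2 : ((θ ^ m : g ≃ₗ[k] g) : g →ₗ[k] g) = (θ : g →ₗ[k] g) ^ m := by
      exact map_pow (LinearEquiv.automorphismGroup.toLinearMapMonoidHom) θ m
    rw [← h2]
    exact this
  have hTH : Commute H T := by
    ext x
    change ⁅h, θ x⁆ = θ ⁅h, x⁆
    rw [hθb, hθh]
  have hTG : ∀ (c : k) x, x ∈ H.maxGenEigenspace c → T x ∈ H.maxGenEigenspace c := fun c x hx =>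
    Module.End.mapsTo_maxGenEigenspace_of_comm hTH c hx
  have hRG : ∀ (c : ℤ) x, x ∈ H.maxGenEigenspace (c : k) → R x = (2 : k) ^ (c + N).toNat • x := by
    intro c x hx
    have := rhoM_gen k g b h w hb N 1 c x hx
    rw [one_add_one_eq_two] at this
    exact this
  have hTR : Commute T R := by
    apply b.ext
    intro i
    change T (R (b i)) = R (T (b i))
    rw [hRG _ _ (hb i), hRG _ _ (hTG _ _ (hb i)), map_smul]
  have hSm : S ^ m = R ^ m := by rw [hTR.mul_pow, hTm, one_mul]
  have hRrepr : ∀ x i, b.repr (R x) i = (2 : k) ^ (w i + N).toNat * b.repr x i := by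
    intro x i
    have := rhoM_repr k g b w N 1 x i
    rw [one_add_one_eq_two] at this
    exact this
  have hRm : ∀ (m : ℕ) x i, b.repr ((R ^ m) x) i = ((2 : k) ^ (w i + N).toNat) ^ m * b.repr x i := by
    intro m
    induction m with
    | zero => intro x i; simp
    | succ m ih => intro x i; rw [pow_succ, Module.End.mul_apply, ih, hRrepr, pow_succ, mul_assoc]
  intro x hx
  rw [Module.End.mem_maxGenEigenspace] at hx
  obtain ⟨r, hr⟩ := hx
  -- the power
  have hdvd : ∃ Q : Module.End k g, S ^ m - (μ ^ m) • 1 = Q * (S - μ • 1) ∧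
      Commute Q (S - μ • 1) := by
    have hc : Commute S (μ • (1 : Module.End k g)) := (Commute.one_right S).smul_right μ
    refine ⟨∑ i ∈ Finset.range m, S ^ i * (μ • (1 : Module.End k g)) ^ (m - 1 - i), ?_, ?_⟩
    · rw [hc.geom_sum₂_mul, smul_pow, one_pow]
    · apply Commute.sum_left
      intro i _
      have c1 : Commute S (S - μ • 1) := (Commute.refl S).sub_right hc
      have c2 : Commute (μ • (1 : Module.End k g)) (S - μ • 1) := hc.symm.sub_right (Commute.refl _)
      exact (c1.pow_left i).mul_left (c2.pow_left _)
  obtain ⟨Q, hQ1, hQ2⟩ := hdvd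
  have hr2 : ((R ^ m - (μ ^ m) • 1) ^ r) x = 0 := by
    rw [← hSm, hQ1, hQ2.mul_pow, Module.End.mul_apply, hr, map_zero]
  have hrepr2 : ∀ (r : ℕ) x i, b.repr (((R ^ m - (μ ^ m) • 1) ^ r) x) i =
      (((2 : k) ^ (w i + N).toNat) ^ m - μ ^ m) ^ r * b.repr x i := by
    intro r
    induction r with
    | zero => intro x i; simp
    | succ r ih =>
      intro x i
      rw [pow_succ, Module.End.mul_apply, ih, LinearMap.sub_apply, map_sub, Finsupp.sub_apply, hRm,
        LinearMap.smul_apply, map_smul, Finsupp.smul_apply, Module.End.one_apply, smul_eq_mul,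
        pow_succ]
      ring
  have hG0 : x ∈ H.maxGenEigenspace ((0 : ℤ) : k) := by
    rw [← b.sum_repr x]
    refine Submodule.sum_mem _ fun i _ => ?_
    by_cases hi : w i = 0
    · rw [← hi]; exact Submodule.smul_mem _ _ (hb i)
    · have h1 := hrepr2 r x i
      rw [hr2, map_zero, Finsupp.zero_apply] at h1
      have h2 : (((2 : k) ^ (w i + N).toNat) ^ m - μ ^ m) ≠ 0 := by
        rw [sub_ne_zero]
        simp only [μ]
        rw [← pow_mul, ← pow_mul]
        intro heq
        have heq2 : (2 : ℕ) ^ ((w i + N).toNat * m) = 2 ^ (N * m) := by exact_mod_cast heq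
        have heq3 := Nat.pow_right_injective (le_refl 2) heq2
        have heq4 := Nat.eq_of_mul_eq_mul_right hm heq3
        have h3 := abs_le.1 (le_refl |w i|)
        have h4 := hN i
        omega
      have h5 : b.repr x i = 0 := by
        rcases mul_eq_zero.1 h1.symm with h6 | h6
        · exact absurd h6 (pow_ne_zero _ h2)
        · exact h6
      rw [h5, zero_smul]; exact Submodule.zero_mem _
  have hST : ∀ (r : ℕ) x, x ∈ H.maxGenEigenspace ((0 : ℤ) : k) →
      ((S - μ • 1) ^ r) x = μ ^ r • ((T - (1 : k) • 1) ^ r) x := by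
    intro r
    induction r with
    | zero => intro x _; simp
    | succ r ih =>
      intro x hx
      have h1 : (S - μ • 1) x = μ • (T - (1 : k) • 1) x := by
        change T (R x) - μ • x = μ • (T x - (1 : k) • x)
        rw [hRG 0 x hx, map_smul, one_smul, smul_sub]
        simp only [μ, zero_add, Int.toNat_natCast]
      rw [pow_succ, Module.End.mul_apply, h1, map_smul, ih, smul_smul, pow_succ', pow_succ,
        Module.End.mul_apply]
      change T x - (1 : k) • x ∈ _
      exact Submodule.sub_mem _ (hTG _ _ hx) (Submodule.smul_mem _ _ hx)
  have hTx : x ∈ T.maxGenEigenspace 1 := by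
    rw [Module.End.mem_maxGenEigenspace]
    refine ⟨r, ?_⟩
    have := hST r x hG0
    rw [hr] at this
    rcases smul_eq_zero.1 this.symm with h6 | h6
    · exact absurd h6 (pow_ne_zero _ hμ0)
    · exact h6
  have hTss : T.IsSemisimple := by
    apply Module.End.isSemisimple_of_squarefree_aeval_eq_zero (p := Polynomial.X ^ m - 1)
    · exact (Polynomial.X_pow_sub_one_separable_iff.2 (by
        have : m ≠ 0 := by omega
        exact_mod_cast this)).squarefree
    · simp [hTm]
  rw [hTss.isFinitelySemisimple.maxGenEigenspace_eq_eigenspace] at hTx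
  rw [Int.cast_zero] at hG0
  exact ⟨hG0, hTx⟩

end PartE
section PartF

theorem finrank_iSup_indep {F : Type*} [Field F] {V : Type*} [AddCommGroup V] [Module F V]
    [FiniteDimensional F V] {ι : Type*} (A : ι → Submodule F V) (hA : iSupIndep A) :
    Module.finrank F ↥(⨆ i, A i) = ∑ᶠ i, Module.finrank F (A i) := by
  classical
  have hfin : {i | A i ≠ ⊥}.Finite := WellFoundedGT.finite_ne_bot_of_iSupIndep hA
  have h1 : ∀ s : Finset ι, Module.finrank F ↥(⨆ i ∈ s, A i) = ∑ i ∈ s, Module.finrank F (A i) := by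
    intro s
    induction s using Finset.induction_on with
    | empty => simp
    | insert a s ha ih =>
      rw [Finset.iSup_insert, Finset.sum_insert ha, ← ih]
      have h := Submodule.finrank_sup_add_finrank_inf_eq (A a) (⨆ i ∈ s, A i)
      have hd : Disjoint (A a) (⨆ i ∈ s, A i) := by
        refine (hA a).mono_right ?_
        refine iSup₂_le fun i hi => ?_
        exact le_iSup₂_of_le i (fun h => ha (h ▸ hi)) le_rfl
      rw [hd.eq_bot, finrank_bot] at h
      simpa using h
  have h2 : (⨆ i, A i) = ⨆ i ∈ hfin.toFinset, A i := by
    apply le_antisymm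
    · refine iSup_le fun i => ?_
      by_cases hi : A i = ⊥
      · rw [hi]; exact bot_le
      · exact le_iSup₂_of_le i (by simpa using hi) le_rfl
    · exact iSup₂_le fun i _ => le_iSup A i
  rw [h2, h1, finsum_eq_sum_of_support_subset]
  intro i hi
  rw [Function.mem_support] at hi
  simp only [Set.Finite.coe_toFinset]
  intro hbot
  apply hi
  rw [hbot, finrank_bot]

end PartF

theorem dim_centralizer_e_piece_eq_kNum
    (m : ℕ) (hm : 1 ≤ m) (ζ : k) (hζ : IsPrimitiveRoot ζ m)
    (θ : g ≃ₗ[k] g) (hθb : ∀ x y : g, θ ⁅x, y⁆ = ⁅θ x, θ y⁆) (hθm : θ ^ m = 1)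
    (hθinner : θ ∈ IntG k g)
    (e h f : g)
    (hhe : ⁅h, e⁆ = (2 : k) • e) (hhf : ⁅h, f⁆ = -((2 : k) • f)) (hef : ⁅e, f⁆ = h)
    (hθe : θ e = ζ • e) (hθh : θ h = h) (hθf : θ f = ζ⁻¹ • f)
    (hen : IsNilpotent (LieAlgebra.ad k g e))
    (her : Module.finrank k (zc k g e) = LieAlgebra.rank k g)
    (i : ZMod m) :
    Module.finrank k ↥(zc k g e ⊓ gradePiece k g ζ θ i) = kNum k g m e h i := by
  let E : Module.End k g := LieAlgebra.ad k g e
  let H : Module.End k g := LieAlgebra.ad k g h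
  let Fm : Module.End k g := LieAlgebra.ad k g f
  have hHE : H * E = E * H + (2 : k) • E := by
    ext x
    change ⁅h, ⁅e, x⁆⁆ = ⁅e, ⁅h, x⁆⁆ + (2 : k) • ⁅e, x⁆
    rw [leibniz_lie h e x, hhe, smul_lie, add_comm]
  have hHF : H * Fm = Fm * H + (-2 : k) • Fm := by
    ext x
    change ⁅h, ⁅f, x⁆⁆ = ⁅f, ⁅h, x⁆⁆ + (-2 : k) • ⁅f, x⁆
    rw [leibniz_lie h f x, hhf, neg_lie, smul_lie, add_comm, neg_smul]
  have hEF : E * Fm = Fm * E + H := by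
    ext x
    change ⁅e, ⁅f, x⁆⁆ = ⁅f, ⁅e, x⁆⁆ + ⁅h, x⁆
    rw [leibniz_lie e f x, hef, add_comm]
  have hIntg : ∀ v : g, v ≠ 0 → ∀ c : k, ⁅h, v⁆ = c • v → ∃ n : ℤ, c = n :=
    fun v hv c hc => sl2_eig_int E H Fm hHE hHF hEF v hv c hc
  have hle := rank_le_fixed k g m hm θ hθb hθm hθinner h hθh hIntg
  have hdim := sl2_dim E H hHE
  have hker : Module.finrank k (LinearMap.ker E) = LieAlgebra.rank k g := her
  have hle2 : Module.finrank k ↥(H.maxGenEigenspace (0 : k) ⊓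
      Module.End.eigenspace (θ : g →ₗ[k] g) 1) ≤ Module.finrank k (H.maxGenEigenspace (0 : k)) :=
    Submodule.finrank_mono inf_le_left
  have hle' : LieAlgebra.rank k g ≤ Module.finrank k ↥(H.maxGenEigenspace (0 : k) ⊓
      Module.End.eigenspace (θ : g →ₗ[k] g) 1) := hle
  have hG1 : ∀ x : g, ⁅h, x⁆ = x → x = 0 := by
    intro x hx
    have h1 : Module.finrank k (H.maxGenEigenspace (1 : k)) = 0 := by omega
    rw [Submodule.finrank_eq_zero] at h1
    have h2 : x ∈ H.maxGenEigenspace (1 : k) := by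
      rw [Module.End.mem_maxGenEigenspace]
      refine ⟨1, ?_⟩
      rw [pow_one, one_smul]
      change ⁅h, x⁆ - x = 0
      rw [hx, sub_self]
    rw [h1] at h2
    exact (Submodule.mem_bot k).1 h2
  have hG0 : ∀ x : g, ⁅h, x⁆ = 0 → θ x = x := by
    intro x hx
    have h1 : H.maxGenEigenspace (0 : k) ⊓ Module.End.eigenspace (θ : g →ₗ[k] g) 1 =
        H.maxGenEigenspace (0 : k) :=
      Submodule.eq_of_le_of_finrank_le inf_le_left (by omega)
    have h2 : x ∈ H.maxGenEigenspace (0 : k) := by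
      rw [Module.End.mem_maxGenEigenspace]
      refine ⟨1, ?_⟩
      rw [pow_one, zero_smul, sub_zero]
      exact hx
    rw [← h1] at h2
    have h3 := Module.End.mem_eigenspace_iff.1 h2.2
    rw [one_smul] at h3
    exact h3
  have hζ0 : ζ ≠ 0 := hζ.ne_zero (by omega)
  -- weights of powers of f
  have hHFj : ∀ (n j : ℕ) v, H v = (n : k) • v → H ((Fm ^ j) v) = ((n : k) - 2 * j) • (Fm ^ j) v := by
    intro n j v hv
    have h1 := LinearMap.congr_fun (E_pow_shift H Fm (-2) hHF j) v
    simp only [Module.End.mul_apply, LinearMap.add_apply, LinearMap.smul_apply] at h1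
    rw [h1, hv, map_smul, ← add_smul]
    congr 1; ring
  have hθF : ∀ (j : ℕ) v, θ ((Fm ^ j) v) = (ζ⁻¹) ^ j • (Fm ^ j) (θ v) := by
    intro j
    induction j with
    | zero => intro v; simp
    | succ j ih =>
      intro v
      rw [pow_succ', Module.End.mul_apply, Module.End.mul_apply]
      change θ ⁅f, (Fm ^ j) v⁆ = _ • ⁅f, (Fm ^ j) (θ v)⁆
      rw [hθb, ih, hθf, smul_lie, lie_smul, smul_smul, pow_succ']
  have hmain : ∀ (n : ℕ) v, E v = 0 → H v = (n : k) • v → v ≠ 0 →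
      ∃ c : ℕ, n = 2 * c ∧ θ v = ζ ^ c • v := by
    intro n v hv hn hv0
    rcases Nat.even_or_odd' n with ⟨c, rfl | rfl⟩
    · refine ⟨c, rfl, ?_⟩
      have h1 : H ((Fm ^ c) v) = 0 := by
        rw [hHFj _ _ _ hn]; push_cast; rw [sub_self, zero_smul]
      have h2 := hG0 _ h1
      rw [hθF] at h2
      have hEθ : E (θ v) = 0 := by
        have h3 : θ ⁅e, v⁆ = ⁅θ e, θ v⁆ := hθb e v
        have h4 : ⁅e, v⁆ = 0 := hv
        rw [h4, map_zero, hθe, smul_lie] at h3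
        exact (smul_eq_zero.1 h3.symm).resolve_left hζ0
      have hHθ : H (θ v) = ((2 * c : ℕ) : k) • θ v := by
        have h3 : θ ⁅h, v⁆ = ⁅θ h, θ v⁆ := hθb h v
        have h4 : ⁅h, v⁆ = ((2 * c : ℕ) : k) • v := hn
        rw [h4, hθh, map_smul] at h3
        exact h3.symm
      have h5 : θ v - ζ ^ c • v = 0 := by
        apply sl2_Finj E H Fm hHF hEF (θ v - ζ ^ c • v) _ (2 * c) _ c (by omega)
        · rw [map_sub, map_smul, ← h2, smul_smul, ← mul_pow, mul_inv_cancel₀ hζ0, one_pow, one_smul,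
            sub_self]
        · rw [map_sub, map_smul, hEθ, hv, smul_zero, sub_zero]
        · rw [map_sub, map_smul, hHθ, hn, smul_sub, smul_comm]
      exact sub_eq_zero.1 h5
    · exfalso
      apply hv0
      apply sl2_Finj E H Fm hHF hEF v hv (2 * c + 1) hn c (by omega)
      apply hG1
      have := hHFj _ c _ hn
      change H _ = _
      rw [this]
      push_cast
      rw [add_sub_cancel_left, one_smul]
  -- decomposition
  let Z : ℤ → Submodule k g := fun c => zc k g e ⊓ H.eigenspace (2 * (c : k))
  have hZθ : ∀ c : ℤ, Z c ≤ Module.End.eigenspace (θ : g →ₗ[k] g) (ζ ^ (c : ZMod m).val) := by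
    intro c v hv
    rw [Module.End.mem_eigenspace_iff]
    by_cases hv0 : v = 0
    · simp [hv0]
    have hE : E v = 0 := hv.1
    have hH := Module.End.mem_eigenspace_iff.1 hv.2
    obtain ⟨n, hn⟩ := sl2_prim_nat E H Fm hHE hHF hEF v hE hv0 _ hH
    rw [hn] at hH
    obtain ⟨c', hc', hθ⟩ := hmain n v hE hH hv0
    have hcc : c = c' := by
      have h1 : ((2 * c : ℤ) : k) = ((n : ℤ) : k) := by push_cast; exact hn
      have h2 := Int.cast_injective h1
      omega
    change θ v = _
    rw [hθ, hcc, Int.cast_natCast, ZMod.val_natCast]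
    congr 1
    have h6 := pow_mod_orderOf ζ c'
    rw [← hζ.eq_orderOf] at h6
    exact h6.symm
  have hsup : zc k g e ≤ ⨆ c : ℤ, Z c := by
    refine (sl2_ker_sup E H Fm hHE hHF hEF).trans (iSup_le fun n => ?_)
    intro v hv
    by_cases hv0 : v = 0
    · rw [hv0]; exact Submodule.zero_mem _
    obtain ⟨c, rfl, -⟩ := hmain n v hv.1 (Module.End.mem_eigenspace_iff.1 hv.2) hv0
    refine Submodule.mem_iSup_of_mem (c : ℤ) ⟨hv.1, ?_⟩
    have := hv.2
    push_cast at this ⊢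
    exact this
  have hZind : iSupIndep Z := by
    have h1 := (Module.End.eigenspaces_iSupIndep H).comp (f := fun c : ℤ => 2 * (c : k)) (by
      intro a b hab
      have h2 : (a : k) = b := mul_left_cancel₀ two_ne_zero hab
      exact Int.cast_injective h2)
    exact h1.mono fun c => inf_le_right
  classical
  let W : ℤ → Submodule k g := fun c => if (c : ZMod m) = i then Z c else ⊥
  have hWind : iSupIndep W := hZind.mono fun c => by
    simp only [W]; split_ifs
    · exact le_rfl
    · exact bot_le
  haveI : NeZero m := ⟨by omega⟩
  have hW1 : (⨆ c, W c) ≤ zc k g e ⊓ gradePiece k g ζ θ i := by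
    refine iSup_le fun c => ?_
    simp only [W]; split_ifs with hc
    · refine le_inf inf_le_left ?_
      have := hZθ c
      rw [hc] at this
      exact this
    · exact bot_le
  have hW2 : zc k g e ⊓ gradePiece k g ζ θ i ≤ ⨆ c, W c := by
    rintro v ⟨hv1, hv2⟩
    let T : Module.End k g := (θ : g →ₗ[k] g)
    let W' : Submodule k g := ⨆ (μ : k) (_ : μ ≠ ζ ^ i.val), T.eigenspace μ
    have h1 : (⨆ c, Z c) ≤ (⨆ c, W c) ⊔ W' := by
      refine iSup_le fun c => ?_
      by_cases hc : (c : ZMod m) = i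
      · refine le_sup_of_le_left (le_iSup_of_le c ?_)
        simp only [W, if_pos hc]; exact le_rfl
      · refine le_sup_of_le_right ?_
        refine le_iSup₂_of_le (ζ ^ (c : ZMod m).val) ?_ (hZθ c)
        intro heq
        apply hc
        apply ZMod.val_injective m
        exact hζ.pow_inj (ZMod.val_lt _) (ZMod.val_lt _) heq
    obtain ⟨a, ha, a', ha', rfl⟩ := Submodule.mem_sup.1 (h1 (hsup hv1))
    have ha2 := (hW1 ha).2
    have ha3 : a' ∈ T.eigenspace (ζ ^ i.val) := by
      have := Submodule.sub_mem _ hv2 ha2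
      rwa [add_sub_cancel_left] at this
    have h0 : a' = 0 :=
      Submodule.disjoint_def.1 (Module.End.eigenspaces_iSupIndep T (ζ ^ i.val)) a' ha3 ha'
    rw [h0, add_zero]; exact ha
  rw [le_antisymm hW2 hW1, finrank_iSup_indep W hWind, kNum]
  apply finsum_congr
  intro c
  by_cases hc : (c : ZMod m) = i
  · have h7 : W c = Z c := if_pos hc
    rw [if_pos hc, h7]
  · have h7 : W c = ⊥ := if_neg hc
    rw [if_neg hc, h7]
    exact finrank_bot k g
end

section
/- Suppose θ is inner and N-regular, and let (e,h,f) be a regular θ-adapted sl2-triple. Then θ acts as the identity on the Cartan subalgebra z(h); that is, z(h) ⊆ g_0. (This is the inner case of the statement that the eigenvalues of θ on z(h) are ε_1^{-1}, …, ε_l^{-1}, the inverses of the factors of θ.) -/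
open LieAlgebra Module

variable (k : Type*) [Field k] [IsAlgClosed k] [CharZero k]
variable (g : Type*) [LieRing g] [LieAlgebra k g] [FiniteDimensional k g]
  [LieAlgebra.IsSemisimple k g]

lemma exists_linear_on_genEig {F V W : Type*} [Field F] [IsAlgClosed F] [AddCommGroup V] [Module F V]
    [FiniteDimensional F V] [AddCommGroup W] [Module F W] (T : Module.End F V)
    (f : F → (V →ₗ[F] W)) :
    ∃ P : V →ₗ[F] W, ∀ μ, ∀ x ∈ T.maxGenEigenspace μ, P x = f μ x := by
  classical
  have hIntEig : DirectSum.IsInternal (fun μ => T.maxGenEigenspace μ) :=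
    DirectSum.isInternal_submodule_of_iSupIndep_of_iSup_eq_top
      (Module.End.independent_maxGenEigenspace T) (Module.End.iSup_maxGenEigenspace_eq_top T)
  have hbij : Function.Bijective (DirectSum.coeLinearMap (fun μ => T.maxGenEigenspace μ)) := hIntEig
  let e := LinearEquiv.ofBijective (DirectSum.coeLinearMap (fun μ => T.maxGenEigenspace μ)) hbij
  refine ⟨(DirectSum.toModule F F W (fun μ => (f μ).comp (T.maxGenEigenspace μ).subtype)).comp
    e.symm.toLinearMap, fun μ x hx => ?_⟩
  have : e.symm x = DirectSum.lof F F (fun μ => T.maxGenEigenspace μ) μ ⟨x, hx⟩ := by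
    rw [LinearEquiv.symm_apply_eq]
    simp only [e, LinearEquiv.ofBijective_apply]
    rw [DirectSum.coeLinearMap_lof]
  simp [this]

lemma genEig_induction {F V : Type*} [Field F] [IsAlgClosed F] [AddCommGroup V] [Module F V]
    [FiniteDimensional F V] (T : Module.End F V) {p : V → Prop}
    (h : ∀ μ, ∀ x ∈ T.maxGenEigenspace μ, p x) (h0 : p 0) (hadd : ∀ x y, p x → p y → p (x + y))
    (x : V) : p x := by
  have hx : x ∈ ⨆ μ, T.maxGenEigenspace μ := by
    rw [Module.End.iSup_maxGenEigenspace_eq_top]; trivial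
  induction hx using Submodule.iSup_induction' with
  | mem i x hx => exact h i x hx
  | zero => exact h0
  | add x y _ _ hx hy => exact hadd x y hx hy

lemma lie_mem_genEig_aut_aux {F L : Type*} [Field F] [LieRing L] [LieAlgebra F L]
    (Φ : Module.End F L) (hΦ : ∀ x y, Φ ⁅x, y⁆ = ⁅Φ x, Φ y⁆) (a b : F) (n : ℕ) :
    ∀ (i j : ℕ) (_ : i + j = n) (x y : L) (_ : ((Φ - a • 1) ^ i) x = 0)
      (_ : ((Φ - b • 1) ^ j) y = 0), ((Φ - (a * b) • 1) ^ n) ⁅x, y⁆ = 0 := by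
  induction n with
  | zero =>
    intro i j hij x y hx hy
    obtain rfl : i = 0 := by omega
    simp at hx
    simp [hx]
  | succ n ih =>
    intro i j hij x y hx hy
    rcases i with _ | i
    · simp at hx; simp [hx]
    rcases j with _ | j
    · simp at hy; simp [hy]
    have key : (Φ - (a * b) • 1) ⁅x, y⁆ = ⁅(Φ - a • 1) x, Φ y⁆ + a • ⁅x, (Φ - b • 1) y⁆ := by
      simp [hΦ, smul_sub, smul_smul]
    rw [pow_succ, Module.End.mul_apply, key, map_add, map_smul]
    have hc : Commute (Φ - b • 1) Φ := by
      apply Commute.sub_left (Commute.refl _)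
      exact (Commute.one_left _).smul_left _
    rw [ih i (j+1) (by omega) _ _ (by rwa [pow_succ] at hx) ?_,
      ih (i+1) j (by omega) _ _ hx (by rwa [pow_succ] at hy), smul_zero, add_zero]
    rw [← Module.End.mul_apply, (hc.pow_left _).eq, Module.End.mul_apply, hy, map_zero]

lemma lie_mem_genEig_aut {F L : Type*} [Field F] [LieRing L] [LieAlgebra F L]
    (Φ : Module.End F L) (hΦ : ∀ x y, Φ ⁅x, y⁆ = ⁅Φ x, Φ y⁆) {a b : F} {x y : L}
    (hx : x ∈ Φ.maxGenEigenspace a) (hy : y ∈ Φ.maxGenEigenspace b) :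
    ⁅x, y⁆ ∈ Φ.maxGenEigenspace (a * b) := by
  rw [Module.End.mem_maxGenEigenspace] at *
  obtain ⟨i, hi⟩ := hx
  obtain ⟨j, hj⟩ := hy
  exact ⟨i + j, lie_mem_genEig_aut_aux Φ hΦ a b _ i j rfl x y hi hj⟩

lemma lie_mem_genEig_der_aux {F L : Type*} [Field F] [LieRing L] [LieAlgebra F L]
    (D : Module.End F L) (hD : ∀ x y, D ⁅x, y⁆ = ⁅D x, y⁆ + ⁅x, D y⁆) (a b : F) (n : ℕ) :
    ∀ (i j : ℕ) (_ : i + j = n) (x y : L) (_ : ((D - a • 1) ^ i) x = 0)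
      (_ : ((D - b • 1) ^ j) y = 0), ((D - (a + b) • 1) ^ n) ⁅x, y⁆ = 0 := by
  induction n with
  | zero =>
    intro i j hij x y hx hy
    obtain rfl : i = 0 := by omega
    simp at hx
    simp [hx]
  | succ n ih =>
    intro i j hij x y hx hy
    rcases i with _ | i
    · simp at hx; simp [hx]
    rcases j with _ | j
    · simp at hy; simp [hy]
    have key : (D - (a + b) • 1) ⁅x, y⁆ = ⁅(D - a • 1) x, y⁆ + ⁅x, (D - b • 1) y⁆ := by
      simp [hD, add_smul]; abel
    rw [pow_succ, Module.End.mul_apply, key, map_add]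
    rw [ih i (j+1) (by omega) _ _ (by rwa [pow_succ] at hx) hy,
      ih (i+1) j (by omega) _ _ hx (by rwa [pow_succ] at hy), add_zero]

lemma lie_mem_genEig_der {F L : Type*} [Field F] [LieRing L] [LieAlgebra F L]
    (D : Module.End F L) (hD : ∀ x y, D ⁅x, y⁆ = ⁅D x, y⁆ + ⁅x, D y⁆) {a b : F} {x y : L}
    (hx : x ∈ D.maxGenEigenspace a) (hy : y ∈ D.maxGenEigenspace b) :
    ⁅x, y⁆ ∈ D.maxGenEigenspace (a + b) := by
  rw [Module.End.mem_maxGenEigenspace] at *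
  obtain ⟨i, hi⟩ := hx
  obtain ⟨j, hj⟩ := hy
  exact ⟨i + j, lie_mem_genEig_der_aux D hD a b _ i j rfl x y hi hj⟩

/-- In a torsion-free commutative group, finitely many nontrivial elements are all detected by a
single rational-valued character of the subgroup they generate. -/
lemma exists_char {G : Type*} [CommGroup G] (S : Set G) (hS : S.Finite)
    (htf : ∀ x ∈ Subgroup.closure S, ∀ n : ℕ, n ≠ 0 → x ^ n = 1 → x = 1) :
    ∃ χ : G → ℚ, (∀ x ∈ Subgroup.closure S, ∀ y ∈ Subgroup.closure S, χ (x * y) = χ x + χ y) ∧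
      ∀ x ∈ S, x ≠ 1 → χ x ≠ 0 := by
  classical
  let Γ := Subgroup.closure S
  have : Group.FG Γ := by
    rw [Group.fg_iff_subgroup_fg]
    exact ⟨hS.toFinset, by simp [Γ]⟩
  have : Module.Finite ℤ (Additive Γ) := Module.Finite.iff_addGroup_fg.mpr inferInstance
  have : IsMulTorsionFree Γ := by
    refine ⟨fun n hn a b hab => ?_⟩
    have h1 : ((a * b⁻¹ : Γ) : G) = 1 := htf _ (a * b⁻¹).2 n hn (by
      have : (a * b⁻¹) ^ n = 1 := by
        rw [mul_pow, inv_pow]; simp only at hab; rw [hab]; simp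
      exact_mod_cast congrArg Subtype.val this)
    have h2 : a * b⁻¹ = 1 := Subtype.ext h1
    exact mul_inv_eq_one.mp h2
  have : IsAddTorsionFree (Additive Γ) := inferInstance
  have : Module.IsTorsionFree ℤ (Additive Γ) := inferInstance
  have : Module.Free ℤ (Additive Γ) := inferInstance
  let b := Module.Free.chooseBasis ℤ (Additive Γ)
  let J : Additive Γ →+ (Module.Free.ChooseBasisIndex ℤ (Additive Γ) → ℚ) :=
    { toFun := fun x i => ((b.repr x i : ℤ) : ℚ)
      map_zero' := by ext; simp
      map_add' := by intros; ext; simp }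
  have hJ : ∀ x, J x = 0 → x = 0 := by
    intro x hx
    apply b.repr.injective
    ext i
    have := congrFun hx i
    simpa [J] using this
  let T := {x : S // (x : G) ≠ 1}
  have : Finite S := hS
  have : Finite T := inferInstance
  let v : T → (Module.Free.ChooseBasisIndex ℤ (Additive Γ) → ℚ) := fun x =>
    J (Additive.ofMul ⟨x.1.1, Subgroup.subset_closure x.1.2⟩)
  obtain ⟨f, hf⟩ := Module.exists_dual_forall_apply_ne_zero (K := ℚ) v (by
    intro x hx
    apply x.2
    have := hJ _ hx
    have h2 : (⟨x.1.1, Subgroup.subset_closure x.1.2⟩ : Γ) = 1 := this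
    exact congrArg Subtype.val h2)
  refine ⟨fun x => if hx : x ∈ Γ then f (J (Additive.ofMul ⟨x, hx⟩)) else 0, ?_, ?_⟩
  · intro x hx y hy
    have hxy : x * y ∈ Γ := mul_mem hx hy
    have hx' : x ∈ Γ := hx
    have hy' : y ∈ Γ := hy
    simp only [hx', hy', hxy, dif_pos]
    rw [← map_add, ← map_add]
    rfl
  · intro x hx h1
    have hx' : x ∈ Γ := Subgroup.subset_closure hx
    simp only [hx', dif_pos]
    exact hf ⟨⟨x, hx⟩, h1⟩

theorem rank_le_of_torsionFree {K L : Type*} [Field K] [IsAlgClosed K] [CharZero K] [LieRing L]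
    [LieAlgebra K L] [FiniteDimensional K L] [IsKilling K L] (Φ : Module.End K L)
    (hΦ : ∀ x y, Φ ⁅x, y⁆ = ⁅Φ x, Φ y⁆) (Γ : Subgroup Kˣ)
    (htf : ∀ x ∈ Γ, ∀ n : ℕ, n ≠ 0 → x ^ n = 1 → x = 1)
    (hev : ∀ μ, Φ.HasEigenvalue μ → ∃ u ∈ Γ, (u : K) = μ) :
    rank K L ≤ finrank K (Φ.maxGenEigenspace 1) := by
  classical
  let S : Set Kˣ := {u | Φ.HasEigenvalue (u : K)}
  have hSf : S.Finite := by
    have : {μ | Φ.HasEigenvalue μ}.Finite := Module.End.finite_hasEigenvalue Φ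
    exact this.preimage (Units.val_injective.injOn)
  have hSΓ : Subgroup.closure S ≤ Γ := by
    rw [Subgroup.closure_le]
    intro u hu
    obtain ⟨w, hw, hwu⟩ := hev _ hu
    rwa [← Units.ext hwu]
  obtain ⟨χ, hχ, hχ0⟩ := exists_char S hSf (fun x hx => htf x (hSΓ hx))
  let c : K → K := fun μ => if h : μ = 0 then 0 else ((χ (Units.mk0 μ h) : ℚ) : K)
  have hc : ∀ u : Kˣ, c u = χ u := by intro u; simp [c]
  obtain ⟨D, hD⟩ := exists_linear_on_genEig Φ (fun μ => c μ • (LinearMap.id : L →ₗ[K] L))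
  simp only [LinearMap.smul_apply, LinearMap.id_apply] at hD
  have hunit : ∀ μ, ∀ x ∈ Φ.maxGenEigenspace μ, x ≠ 0 → ∃ u ∈ S, (u : K) = μ := by
    intro μ x hx hx0
    have : Φ.HasEigenvalue μ := by
      refine (Module.End.hasUnifEigenvalue_iff_hasUnifEigenvalue_one (k := ⊤) (by simp)).mp ?_
      intro hbot
      have hx' : x ∈ Φ.genEigenspace μ ⊤ := hx
      rw [hbot] at hx'
      exact hx0 (by simpa using hx')
    obtain ⟨u, -, hu⟩ := hev μ this
    exact ⟨u, by simpa [S, hu] using this, hu⟩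
  have hder : ∀ x y, D ⁅x, y⁆ = ⁅D x, y⁆ + ⁅x, D y⁆ := by
    intro x y
    induction x using genEig_induction Φ with
    | h0 => simp
    | hadd x x' h h' => simp [h, h']; abel
    | h μ x hx =>
    induction y using genEig_induction Φ with
    | h0 => simp
    | hadd x x' h h' => simp [h, h']; abel
    | h ν y hy =>
    by_cases hx0 : x = 0
    · simp [hx0]
    by_cases hy0 : y = 0
    · simp [hy0]
    obtain ⟨u, hu, rfl⟩ := hunit _ _ hx hx0
    obtain ⟨w, hw, rfl⟩ := hunit _ _ hy hy0
    rw [hD _ _ hx, hD _ _ hy, hD _ _ (lie_mem_genEig_aut Φ hΦ hx hy), ← Units.val_mul, hc, hc, hc,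
      hχ u (Subgroup.subset_closure hu) w (Subgroup.subset_closure hw)]
    simp [add_smul]
  let D' : LieDerivation K L L :=
    { toLinearMap := D
      leibniz' := by
        intro a b
        rw [hder, ← lie_skew b (D a)]; abel }
  obtain ⟨y, hy⟩ := LieDerivation.IsKilling.exists_eq_ad D'
  have hyD : LieAlgebra.ad K L y = D := by
    ext x
    have := congrArg (fun E : LieDerivation K L L => E x) hy
    exact (by simpa using this : ⁅y, x⁆ = D' x)
  have h1 := rank_le_natTrailingDegree_charpoly_ad K y
  rw [hyD, ← LinearMap.finrank_maxGenEigenspace_zero_eq] at h1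
  refine h1.trans (Submodule.finrank_mono ?_)
  -- the generalized kernel of `D` lies in the generalized `1`-eigenspace
  obtain ⟨Q, hQ⟩ := exists_linear_on_genEig Φ
    (fun μ => if μ = 1 then (0 : L →ₗ[K] L) else LinearMap.id)
  obtain ⟨R, hR⟩ := exists_linear_on_genEig Φ
    (fun μ => if μ = 1 then (0 : L →ₗ[K] L) else (c μ)⁻¹ • LinearMap.id)
  have hRD : ∀ x, R (D x) = Q x := by
    intro x
    induction x using genEig_induction Φ with
    | h0 => simp
    | hadd x x' h h' => simp [h, h']
    | h μ x hx =>
    rw [hD _ _ hx, map_smul, hR _ _ hx, hQ _ _ hx]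
    by_cases hμ : μ = 1
    · simp [hμ]
    by_cases hx0 : x = 0
    · simp [hx0]
    obtain ⟨u, hu, rfl⟩ := hunit _ _ hx hx0
    have : c u ≠ 0 := by
      rw [hc]
      have := hχ0 u hu (by rintro rfl; simp at hμ)
      exact_mod_cast this
    simp [hμ, smul_smul, this]
  have hQQ : ∀ x, Q (Q x) = Q x := by
    intro x
    induction x using genEig_induction Φ with
    | h0 => simp
    | hadd x x' h h' => simp [h, h']
    | h μ x hx =>
    rw [hQ _ _ hx]
    split_ifs with h
    · simp
    · simp [hQ _ _ hx, h]
  have hQD : ∀ x, Q (D x) = D (Q x) := by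
    intro x
    induction x using genEig_induction Φ with
    | h0 => simp
    | hadd x x' h h' => simp [h, h']
    | h μ x hx =>
    rw [hD _ _ hx, map_smul, hQ _ _ hx]
    split_ifs with h
    · simp
    · simp [hD _ _ hx]
  have hQ1 : ∀ x, x - Q x ∈ Φ.maxGenEigenspace 1 := by
    intro x
    induction x using genEig_induction Φ with
    | h0 => simp
    | hadd x x' h h' => simpa [add_sub_add_comm] using add_mem h h'
    | h μ x hx =>
    rw [hQ _ _ hx]
    split_ifs with h
    · subst h; simpa using hx
    · simp
  intro x hx
  rw [Module.End.mem_maxGenEigenspace] at hx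
  obtain ⟨n, hn⟩ := hx
  rw [zero_smul, sub_zero] at hn
  have : Q x = 0 := by
    have hker : ∀ n, ∀ x, (D ^ n) x = 0 → Q x = 0 := by
      intro n
      induction n with
      | zero => intro x hx; simp at hx; simp [hx]
      | succ n ih =>
        intro x hx
        rw [pow_succ, Module.End.mul_apply] at hx
        have := ih _ hx
        rw [hQD] at this
        have h2 := hRD (Q x)
        rw [this, map_zero, hQQ] at h2
        exact h2.symm
    exact hker n x hn
  have h3 := hQ1 x
  rwa [this, sub_zero] at h3

open scoped TensorProduct

/-- Specialisation `A ⊗ L → L` along `ε : A → F`. -/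
noncomputable def spec {F A L : Type*} [Field F] [CommRing A] [Algebra F A] [LieRing L]
    [LieAlgebra F L] (ε : A →ₐ[F] F) : A ⊗[F] L →ₗ[F] L :=
  (TensorProduct.lid F L).toLinearMap ∘ₗ TensorProduct.map ε.toLinearMap LinearMap.id

section spec
variable {F A L : Type*} [Field F] [CommRing A] [Algebra F A] [LieRing L] [LieAlgebra F L]
  (ε : A →ₐ[F] F)

lemma spec_tmul (a : A) (x : L) : spec ε (a ⊗ₜ[F] x) = ε a • x := by simp [spec]

lemma spec_smul (a : A) (z : A ⊗[F] L) : spec ε (a • z) = ε a • spec ε z := by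
  induction z with
  | zero => simp
  | add x y hx hy => simp [hx, hy]
  | tmul b x => simp [TensorProduct.smul_tmul', spec_tmul, mul_smul]

lemma spec_lie (z w : A ⊗[F] L) : spec ε ⁅z, w⁆ = ⁅spec ε z, spec ε w⁆ := by
  induction z with
  | zero => simp
  | add x y hx hy => simp [hx, hy]
  | tmul a x =>
  induction w with
  | zero => simp
  | add x y hx hy => simp [hx, hy]
  | tmul b y => simp [spec_tmul, ExtendScalars.bracket_tmul, mul_smul, smul_comm (ε a) (ε b)]
end spec

/-- `Φ` is a multiplicative family on `A ⊗ L`, equal to the identity at `ε₀` and to `τ` at `ε₁`. -/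
def IsFamily {F A L : Type*} [Field F] [CommRing A] [Algebra F A] [LieRing L]
    [LieAlgebra F L] (ε₀ ε₁ : A →ₐ[F] F) (Φ : A ⊗[F] L →ₗ[A] A ⊗[F] L) (τ : L →ₗ[F] L) : Prop :=
  (∀ x y, Φ ⁅x, y⁆ = ⁅Φ x, Φ y⁆) ∧ (∀ z, spec ε₀ (Φ z) = spec ε₀ z) ∧
    (∀ z, spec ε₁ (Φ z) = τ (spec ε₁ z))

section family
variable {F A L : Type*} [Field F] [CommRing A] [Algebra F A] [LieRing L] [LieAlgebra F L]
  {ε₀ ε₁ : A →ₐ[F] F}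

lemma IsFamily.comp {Φ Ψ : A ⊗[F] L →ₗ[A] A ⊗[F] L} {σ τ : L →ₗ[F] L}
    (h : IsFamily ε₀ ε₁ Φ σ) (h' : IsFamily ε₀ ε₁ Ψ τ) :
    IsFamily ε₀ ε₁ (Φ ∘ₗ Ψ) (σ ∘ₗ τ) :=
  ⟨fun x y => by simp [h'.1, h.1], fun z => by simp [h'.2.1, h.2.1],
    fun z => by simp [h'.2.2, h.2.2]⟩

lemma IsFamily.symm {Φ : A ⊗[F] L ≃ₗ[A] A ⊗[F] L} {τ : L ≃ₗ[F] L}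
    (h : IsFamily ε₀ ε₁ Φ.toLinearMap τ.toLinearMap) :
    IsFamily ε₀ ε₁ Φ.symm.toLinearMap τ.symm.toLinearMap := by
  obtain ⟨h1, h2, h3⟩ := h
  refine ⟨fun x y => ?_, fun z => ?_, fun z => ?_⟩
  · apply Φ.injective
    have := h1 (Φ.symm x) (Φ.symm y)
    simp at this
    simp [this]
  · have := h2 (Φ.symm z)
    simpa using this.symm
  · have := h3 (Φ.symm z)
    simp at this
    simp [this]

end family

lemma exists_family_exp {F A L : Type*} [Field F] [CharZero F] [CommRing A] [Algebra F A]
    [LieRing L] [LieAlgebra F L] [FiniteDimensional F L] {ε₀ ε₁ : A →ₐ[F] F}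
    (u : A) (h0 : ε₀ u = 0) (h1 : ε₁ u = 1) (n : L) (hn : IsNilpotent (LieAlgebra.ad F L n))
    (τ : L ≃ₗ[F] L) (hτ : (τ : L →ₗ[F] L) = ∑ i ∈ Finset.range (Module.finrank F L + 1),
      ((i.factorial : F))⁻¹ • (LieAlgebra.ad F L n) ^ i) :
    ∃ Φ : A ⊗[F] L ≃ₗ[A] A ⊗[F] L, IsFamily ε₀ ε₁ Φ.toLinearMap τ.toLinearMap := by
  letI : Module ℚ (A ⊗[F] L) := Module.compHom (A ⊗[F] L) (algebraMap ℚ F)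
  have hq : ∀ (q : ℚ) (z : A ⊗[F] L), q • z = (q : F) • z := fun q z => by
    change (algebraMap ℚ F q) • z = _
    simp
  letI : LieAlgebra ℚ (A ⊗[F] L) := { lie_smul := by intro q x y; rw [hq, hq, lie_smul] }
  let Y : A ⊗[F] L := u ⊗ₜ n
  have hpow : ∀ i : ℕ, ∀ (a : A) (x : L),
      ((LieAlgebra.ad A (A ⊗[F] L) Y) ^ i) (a ⊗ₜ x) = (u ^ i * a) ⊗ₜ (((LieAlgebra.ad F L n) ^ i) x) := by
    intro i a x
    induction i with
    | zero => simp
    | succ i ih =>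
      rw [pow_succ', Module.End.mul_apply, ih, pow_succ' (LieAlgebra.ad F L n), Module.End.mul_apply]
      simp [Y, ExtendScalars.bracket_tmul, pow_succ', mul_assoc]
  have hN : (LieAlgebra.ad F L n) ^ (finrank F L + 1) = 0 := by
    have := (LinearMap.charpoly_nilpotent_tfae (LieAlgebra.ad F L n)).out 0 1
    have hcp := LinearMap.aeval_self_charpoly (LieAlgebra.ad F L n)
    rw [(LinearMap.isNilpotent_iff_charpoly _).mp hn] at hcp
    simp at hcp
    rw [pow_succ, hcp, zero_mul]
  have hNY : (LieAlgebra.ad A (A ⊗[F] L) Y) ^ (finrank F L + 1) = 0 := by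
    apply LinearMap.ext
    intro z
    induction z with
    | zero => simp
    | add x y hx hy => rw [map_add, hx, hy]; simp
    | tmul a x => rw [hpow, hN]; simp
  let D : LieDerivation A (A ⊗[F] L) (A ⊗[F] L) := LieDerivation.ad A (A ⊗[F] L) Y
  have hD : D.toLinearMap = LieAlgebra.ad A (A ⊗[F] L) Y := by
    apply LinearMap.ext; intro z; simp [D]
  have hDn : IsNilpotent D.toLinearMap := ⟨_, hD ▸ hNY⟩
  let E := LieDerivation.exp D hDn
  have hE : ∀ z, E z = ∑ i ∈ Finset.range (finrank F L + 1),
      ((i.factorial : F))⁻¹ • ((LieAlgebra.ad A (A ⊗[F] L) Y) ^ i) z := by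
    intro z
    simp only [E]
    rw [LieDerivation.exp_map_apply, IsNilpotent.exp_eq_sum (k := finrank F L + 1) (hD ▸ hNY), hD]
    simp [hq]
  have hspow : ∀ (ε : A →ₐ[F] F) (i : ℕ) (z : A ⊗[F] L),
      spec ε (((LieAlgebra.ad A (A ⊗[F] L) Y) ^ i) z) =
        (ε u) ^ i • ((LieAlgebra.ad F L n) ^ i) (spec ε z) := by
    intro ε i z
    induction i with
    | zero => simp
    | succ i ih =>
      rw [pow_succ', Module.End.mul_apply, LieAlgebra.ad_apply, spec_lie, ih,
        pow_succ' (LieAlgebra.ad F L n), Module.End.mul_apply]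
      simp [Y, spec_tmul, pow_succ', mul_smul]
      rw [smul_comm]
  refine ⟨E.toLinearEquiv, fun x y => ?_, fun z => ?_, fun z => ?_⟩
  · exact LieEquiv.map_lie E x y
  · change spec ε₀ (E z) = _
    rw [hE, map_sum, Finset.sum_range_succ']
    simp [hspow, h0]
  · change spec ε₁ (E z) = (τ : L →ₗ[F] L) _
    rw [hE, map_sum, hτ]
    simp [hspow, h1]

lemma charpoly_semilinear {A B M N ι : Type*} [CommRing A] [CommRing B] [Nontrivial A]
    [AddCommGroup M] [Module A M] [AddCommGroup N]
    [Module B N] [Fintype ι] [DecidableEq ι] (φ : A →+* B) (bM : Basis ι A M) (bN : Basis ι B N)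
    [Module.Free A M] [Module.Finite A M] [Module.Free B N] [Module.Finite B N]
    (s : M →+ N) (hs : ∀ a m, s (a • m) = φ a • s m) (hb : ∀ i, s (bM i) = bN i)
    (Φ : M →ₗ[A] M) (Ψ : N →ₗ[B] N) (h : ∀ m, Ψ (s m) = s (Φ m)) :
    Ψ.charpoly = Φ.charpoly.map φ := by
  have hr : ∀ m i, bN.repr (s m) i = φ (bM.repr m i) := by
    intro m i
    conv_lhs => rw [← bM.sum_repr m]
    rw [map_sum]
    simp only [hs, hb]
    rw [bN.repr_sum_self]
  rw [← LinearMap.charpoly_toMatrix Ψ bN, ← LinearMap.charpoly_toMatrix Φ bM, ← Matrix.charpoly_map]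
  congr 1
  ext i j
  rw [LinearMap.toMatrix_apply, ← hb, h, hr]
  simp [LinearMap.toMatrix_apply]

section baseChange
variable (F K L : Type*) [Field F] [Field K] [Algebra F K] [LieRing L]
    [LieAlgebra F L] [FiniteDimensional F L]

lemma isKilling_baseChange [IsKilling F L] : IsKilling K (K ⊗[F] L) := by
  classical
  let b := Module.finBasis F L
  let bK := Algebra.TensorProduct.basis K b
  have h0 := IsKilling.killingForm_nondegenerate F L
  have h1 : (killingForm K (K ⊗[F] L)).Nondegenerate := by
    rw [LinearMap.BilinForm.nondegenerate_iff_det_ne_zero bK]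
    rw [LinearMap.BilinForm.nondegenerate_iff_det_ne_zero b] at h0
    have : LinearMap.BilinForm.toMatrix bK (killingForm K (K ⊗[F] L)) =
        (algebraMap F K).mapMatrix (LinearMap.BilinForm.toMatrix b (killingForm F L)) := by
      ext i j
      have hb : ∀ i, bK i = 1 ⊗ₜ[F] b i := fun i => Algebra.TensorProduct.basis_apply _ _
      rw [LinearMap.BilinForm.toMatrix_apply, hb, hb]
      have h2 : killingForm K (K ⊗[F] L) = (LieModule.traceForm F L L).baseChange K :=
        LieModule.traceForm_baseChange ..
      rw [h2, LinearMap.BilinForm.baseChange_tmul]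
      simp [LinearMap.BilinForm.toMatrix_apply, killingForm, Algebra.algebraMap_eq_smul_one]
    rw [this, ← RingHom.map_det]
    simpa using h0
  refine ⟨?_⟩
  rw [eq_bot_iff]
  intro x hx
  rw [LieIdeal.mem_killingCompl] at hx
  have := h1.2 x (fun y => hx y (by trivial))
  simpa using this

attribute [local instance] LieRing.ofAssociativeRing

lemma rank_baseChange : rank F L ≤ rank K (K ⊗[F] L) := by
  classical
  let b := Module.finBasis F L
  let bK := Algebra.TensorProduct.basis K b
  have h := LinearMap.polyCharpoly_baseChange (φ := (ad F L).toLinearMap) (b := b) K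
  have h2 : LinearMap.tensorProduct F K L L ∘ₗ (ad F L).toLinearMap.baseChange K =
      (ad K (K ⊗[F] L)).toLinearMap := by
    ext x y
    simp [LinearMap.tensorProduct]
  rw [h2] at h
  have h3 := LieAlgebra.polyCharpoly_coeff_rank_ne_zero (R := K) (b := bK)
  rw [LieAlgebra.rank_eq_natTrailingDegree (R := F) (b := b)]
  apply Polynomial.natTrailingDegree_le_of_ne_zero
  intro h4
  apply h3
  rw [h, Polynomial.coeff_map, h4, map_zero]
end baseChange

open Polynomial in
lemma exists_torsionFree_of_roots {F A K : Type*} [Field F] [CharZero F] [CommRing A] [Algebra F A]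
    [Field K] [Algebra F K] (j : A →ₐ[F] K) (hj : Function.Injective j) (ε : A →ₐ[F] F)
    (p : A[X]) (hp : p.Monic) (n : ℕ) (hpn : p.map (ε : A →+* F) = (X - 1) ^ n) :
    ∃ Γ : Subgroup Kˣ, (∀ x ∈ Γ, ∀ n : ℕ, n ≠ 0 → x ^ n = 1 → x = 1) ∧
      ∀ μ : K, (p.map (j : A →+* K)).IsRoot μ → ∃ u ∈ Γ, (u : K) = μ := by
  let R : Subring K := (j : A →+* K).range
  let I : Ideal R := Ideal.comap (RingEquiv.symm (RingEquiv.ofBijective (j : A →+* K).rangeRestrict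
    ⟨fun a b hab => hj (congrArg Subtype.val hab), (j : A →+* K).rangeRestrict_surjective⟩) : R →+* A)
    (RingHom.ker (ε : A →+* F))
  have hI : I ≠ ⊤ := by
    rw [Ideal.ne_top_iff_one]
    simp [I]
  obtain ⟨O, hO, hOI⟩ := Ideal.image_subset_nonunits_valuationSubring I hI
  have hO1 : ∀ a, j a ∈ O := fun a => hO ⟨a, rfl⟩
  have hO2 : ∀ a, ε a = 0 → O.valuation (j a) < 1 := by
    intro a ha
    refine hOI ⟨⟨j a, ⟨a, rfl⟩⟩, ?_, rfl⟩
    simp only [I, SetLike.mem_coe, Ideal.mem_comap]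
    have : (RingEquiv.symm (RingEquiv.ofBijective (j : A →+* K).rangeRestrict
      ⟨fun a b hab => hj (congrArg Subtype.val hab),
        (j : A →+* K).rangeRestrict_surjective⟩) : R →+* A) ⟨j a, ⟨a, rfl⟩⟩ = a := by
      change (RingEquiv.symm (RingEquiv.ofBijective (j : A →+* K).rangeRestrict _)) _ = a
      rw [RingEquiv.symm_apply_eq]
      rfl
    rw [this]
    exact ha
  refine ⟨O.principalUnitGroup, ?_, ?_⟩
  · intro x hx a ha hxa
    by_contra hne
    have h1 : ((x : K) - 1) ≠ 0 := fun h => hne (Units.ext (by simpa [sub_eq_zero] using h))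
    have h2 : (∑ i ∈ Finset.range a, (x : K) ^ i) = 0 := by
      have := geom_sum_mul (x : K) a
      rw [← Units.val_pow_eq_pow_val, hxa] at this
      simpa [h1] using this
    have h3 : (a : K) = - ∑ i ∈ Finset.range a, ((x : K) ^ i - 1) := by
      rw [Finset.sum_sub_distrib, h2]; simp
    have h4 : O.valuation (a : K) < 1 := by
      rw [h3, Valuation.map_neg]
      refine Valuation.map_sum_lt _ one_ne_zero fun i _ => ?_
      have := (O.mem_principalUnitGroup_iff (x ^ i)).mp (pow_mem hx i)
      simpa using this
    have h5 : O.valuation ((a : K)⁻¹) ≤ 1 := by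
      rw [O.valuation_le_one_iff]
      have := hO1 (algebraMap F A ((a : F)⁻¹))
      simpa using this
    have h6 : O.valuation (a : K) * O.valuation ((a : K)⁻¹) = 1 := by
      rw [← map_mul, mul_inv_cancel₀, map_one]
      have : algebraMap F K (a : F) ≠ 0 := by
        rw [_root_.map_ne_zero]; exact Nat.cast_ne_zero.mpr ha
      rwa [map_natCast] at this
    have h7 : O.valuation (a : K) * O.valuation ((a : K)⁻¹) < 1 := mul_lt_one_of_lt_of_le h4 h5
    exact h7.ne h6
  · intro μ hμ
    have hμO : μ ∈ O := by
      let jO : A →+* O := (j : A →+* K).codRestrict O hO1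
      have hIntEig : IsIntegral O μ := by
        refine ⟨p.map jO, hp.map _, ?_⟩
        rw [eval₂_map]
        rw [IsRoot, eval_map] at hμ
        exact hμ
      obtain ⟨y, hy⟩ := IsIntegrallyClosed.isIntegral_iff.mp hIntEig
      rw [← hy]
      exact y.2
    have hv : O.valuation μ ≤ 1 := (O.valuation_le_one_iff _).mpr hμO
    let q : A[X] := p - (X - 1) ^ n
    have hq : ∀ i, ε (q.coeff i) = 0 := by
      intro i
      have : (q.map (ε : A →+* F)).coeff i = 0 := by simp [q, hpn]
      rwa [coeff_map] at this
    have hqv : O.valuation (q.eval₂ (j : A →+* K) μ) < 1 := by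
      rw [eval₂_eq_sum_range]
      refine Valuation.map_sum_lt _ one_ne_zero fun i _ => ?_
      rw [map_mul, map_pow]
      exact mul_lt_one_of_lt_of_le (hO2 _ (hq i)) (pow_le_one₀ zero_le hv)
    have hq2 : q.eval₂ (j : A →+* K) μ = - (μ - 1) ^ n := by
      rw [IsRoot, eval_map] at hμ
      simp only [q]
      rw [eval₂_sub, hμ, eval₂_pow, eval₂_sub, eval₂_X, eval₂_one, zero_sub]
    rw [hq2, Valuation.map_neg, map_pow] at hqv
    have h8 : O.valuation (μ - 1) < 1 := by
      by_contra h
      exact absurd hqv (not_lt.mpr (one_le_pow₀ (not_lt.mp h)))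
    have hμ0 : μ ≠ 0 := by
      rintro rfl
      simp at h8
    exact ⟨Units.mk0 μ hμ0, (O.mem_principalUnitGroup_iff _).mpr (by simpa using h8), rfl⟩

theorem rank_le_of_family {F A L : Type*} [Field F] [CharZero F] [CommRing A] [IsDomain A]
    [Algebra F A] [LieRing L] [LieAlgebra F L] [FiniteDimensional F L] [IsKilling F L]
    {ε₀ ε₁ : A →ₐ[F] F} {Φ : A ⊗[F] L →ₗ[A] A ⊗[F] L} {τ : L →ₗ[F] L}
    (h : IsFamily ε₀ ε₁ Φ τ) : rank F L ≤ finrank F (Module.End.maxGenEigenspace τ 1) := by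
  classical
  obtain ⟨hm, hs0, hs1⟩ := h
  let K := AlgebraicClosure (FractionRing A)
  let j : A →ₐ[F] K := IsScalarTower.toAlgHom F A K
  have hj : Function.Injective j := by
    have h1 : Function.Injective (algebraMap A (FractionRing A)) := IsFractionRing.injective _ _
    have h2 : Function.Injective (algebraMap (FractionRing A) K) := RingHom.injective _
    have : (j : A → K) = algebraMap (FractionRing A) K ∘ algebraMap A (FractionRing A) := by
      ext a
      exact IsScalarTower.algebraMap_apply A (FractionRing A) K a
    rw [this]
    exact h2.comp h1
  let b := Module.finBasis F L
  let bA := Algebra.TensorProduct.basis A b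
  let bK := Algebra.TensorProduct.basis K b
  have hbA : ∀ i, bA i = 1 ⊗ₜ[F] b i := fun i => Algebra.TensorProduct.basis_apply _ _
  have hbK : ∀ i, bK i = 1 ⊗ₜ[F] b i := fun i => Algebra.TensorProduct.basis_apply _ _
  have hcp : ∀ (ε : A →ₐ[F] F) (σ : L →ₗ[F] L), (∀ z, spec ε (Φ z) = σ (spec ε z)) →
      σ.charpoly = Φ.charpoly.map (ε : A →+* F) := by
    intro ε σ hσ
    refine charpoly_semilinear (ε : A →+* F) bA b (spec ε).toAddMonoidHom ?_ ?_ Φ σ ?_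
    · intro a z; exact spec_smul ε a z
    · intro i; simp [hbA, spec_tmul]
    · intro z; exact (hσ z).symm
  have hc0 := hcp ε₀ LinearMap.id hs0
  have hc1 := hcp ε₁ τ hs1
  -- base change to `K`
  let s : A ⊗[F] L →ₗ[F] K ⊗[F] L := TensorProduct.map j.toLinearMap LinearMap.id
  have hst : ∀ a x, s (a ⊗ₜ[F] x) = j a ⊗ₜ x := fun a x => by simp [s]
  have hss : ∀ (a : A) z, s (a • z) = j a • s z := by
    intro a z
    induction z with
    | zero => simp
    | add x y hx hy => simp [hx, hy]
    | tmul b x => simp [TensorProduct.smul_tmul', hst]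
  have hsl : ∀ z w, s ⁅z, w⁆ = ⁅s z, s w⁆ := by
    intro z w
    induction z with
    | zero => simp
    | add x y hx hy => simp [hx, hy]
    | tmul a x =>
    induction w with
    | zero => simp
    | add x y hx hy => simp [hx, hy]
    | tmul b y => simp [hst, ExtendScalars.bracket_tmul]
  let Ψ : K ⊗[F] L →ₗ[K] K ⊗[F] L := LinearMap.liftBaseChange K
    (s ∘ₗ (Φ.restrictScalars F) ∘ₗ (TensorProduct.mk F A L 1))
  have hΨt : ∀ (c : K) (x : L), Ψ (c ⊗ₜ x) = c • s (Φ (1 ⊗ₜ x)) := by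
    intro c x; simp [Ψ]
  have hΨs : ∀ z, Ψ (s z) = s (Φ z) := by
    intro z
    induction z with
    | zero => simp
    | add x y hx hy => simp [hx, hy]
    | tmul a x =>
      rw [hst, hΨt, ← hss, ← map_smul, TensorProduct.smul_tmul', smul_eq_mul, mul_one]
  have hΨm : ∀ z w, Ψ ⁅z, w⁆ = ⁅Ψ z, Ψ w⁆ := by
    intro z w
    induction z with
    | zero => simp
    | add x y hx hy => simp [hx, hy]
    | tmul a x =>
    induction w with
    | zero => simp
    | add x y hx hy => simp [hx, hy]
    | tmul b y =>
      rw [ExtendScalars.bracket_tmul, hΨt, hΨt, hΨt, smul_lie, lie_smul, ← hsl, ← hm,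
        ExtendScalars.bracket_tmul, mul_one, mul_smul]
  have hcK : Ψ.charpoly = Φ.charpoly.map (j : A →+* K) := by
    refine charpoly_semilinear (j : A →+* K) bA bK s.toAddMonoidHom ?_ ?_ Φ Ψ hΨs
    · intro a z; exact hss a z
    · intro i; simp [hbA, hbK, hst]
  have hc0' : Φ.charpoly.map (ε₀ : A →+* F) = (Polynomial.X - 1) ^ finrank F L := by
    rw [← hc0]
    exact LinearMap.charpoly_one ..
  obtain ⟨Γ, hΓ1, hΓ2⟩ := exists_torsionFree_of_roots j hj ε₀ Φ.charpoly
    (LinearMap.charpoly_monic _) _ hc0'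
  have : CharZero K := charZero_of_injective_algebraMap (algebraMap F K).injective
  have : IsKilling K (K ⊗[F] L) := isKilling_baseChange F K L
  have hr := rank_le_of_torsionFree (K := K) Ψ hΨm Γ hΓ1 (by
    intro μ hμ
    apply hΓ2
    rw [← hcK]
    exact (Module.End.hasEigenvalue_iff_isRoot_charpoly Ψ μ).mp hμ)
  have hr2 := (rank_baseChange F K L).trans hr
  rw [LinearMap.finrank_maxGenEigenspace_eq] at hr2 ⊢
  rw [Polynomial.le_rootMultiplicity_iff (LinearMap.charpoly_monic _).ne_zero] at hr2 ⊢
  have hd : (Polynomial.X - Polynomial.C (1 : A)) ^ (rank F L) ∣ Φ.charpoly := by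
    rw [← Polynomial.map_dvd_map (j : A →+* K) hj ((Polynomial.monic_X_sub_C _).pow _), ← hcK]
    simpa using hr2
  have := Polynomial.map_dvd (ε₁ : A →+* F) hd
  rw [← hc1] at this
  simpa using this

lemma sl2_eigenvalue_int {F L : Type*} [Field F] [CharZero F] [LieRing L] [LieAlgebra F L]
    [FiniteDimensional F L] (e h f : L)
    (hhe : ⁅h, e⁆ = (2 : F) • e) (hhf : ⁅h, f⁆ = -((2 : F) • f)) (hef : ⁅e, f⁆ = h)
    (hen : IsNilpotent (LieAlgebra.ad F L e)) (μ : F)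
    (hμ : Module.End.HasEigenvalue (LieAlgebra.ad F L h) μ) : ∃ j : ℤ, μ = j := by
  obtain ⟨v, hv⟩ := hμ.exists_hasEigenvector
  have hv0 := hv.2
  have hv1 : ⁅h, v⁆ = μ • v := hv.apply_eq_smul
  by_cases hh : h = 0
  · refine ⟨0, ?_⟩
    rw [hh, zero_lie] at hv1
    simpa [hv0] using hv1.symm
  have t : IsSl2Triple h e f := ⟨hh, hef, by rw [hhe, two_smul, two_nsmul],
    by rw [hhf, two_smul, two_nsmul]⟩
  have hpow : ∀ n : ℕ, ⁅h, ((LieAlgebra.ad F L e) ^ n) v⁆ =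
      (μ + 2 * n) • ((LieAlgebra.ad F L e) ^ n) v := by
    intro n
    induction n with
    | zero => simpa using hv1
    | succ n ih =>
      rw [pow_succ', Module.End.mul_apply, LieAlgebra.ad_apply, leibniz_lie, ih, hhe, smul_lie,
        lie_smul, ← add_smul]
      congr 1
      push_cast
      ring
  have hex : ∃ n : ℕ, ((LieAlgebra.ad F L e) ^ n) v = 0 := by
    obtain ⟨n, hn⟩ := hen
    exact ⟨n, by rw [hn]; rfl⟩
  obtain ⟨n, hn1, hn2⟩ := Nat.exists_not_and_succ_of_not_zero_of_exists
    (p := fun n => ((LieAlgebra.ad F L e) ^ n) v = 0) (by simpa using hv0) hex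
  have P : t.HasPrimitiveVectorWith (((LieAlgebra.ad F L e) ^ n) v) (μ + 2 * n) :=
    ⟨hn1, hpow n, by rwa [pow_succ', Module.End.mul_apply, LieAlgebra.ad_apply] at hn2⟩
  obtain ⟨q, hq⟩ := P.exists_nat
  refine ⟨q - 2 * n, ?_⟩
  push_cast
  rw [← hq]
  ring

lemma finrank_genEig_zero_le {F V : Type*} [Field F] [CharZero F] [AddCommGroup V] [Module F V]
    [FiniteDimensional F V] (E H : Module.End F V) (hE : IsNilpotent E)
    (hEH : ∀ a, ∀ x ∈ H.maxGenEigenspace a, E x ∈ H.maxGenEigenspace (a + 2)) :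
    finrank F (H.maxGenEigenspace 0) ≤ finrank F (LinearMap.ker E) := by
  have key : ∀ n : ℕ, ∀ a : F, ∃ S : Submodule F V, S ≤ LinearMap.ker E ∧
      S ≤ ⨆ i : ℕ, H.maxGenEigenspace (a + 2 * i) ∧
      finrank F ↥(H.maxGenEigenspace a ⊓ LinearMap.ker (E ^ n)) ≤ finrank F S := by
    intro n
    induction n with
    | zero =>
      intro a
      refine ⟨⊥, bot_le, bot_le, ?_⟩
      have : LinearMap.ker (E ^ 0) = ⊥ := by
        rw [pow_zero]; exact LinearMap.ker_id
      rw [this, inf_bot_eq]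
    | succ n ih =>
      intro a
      obtain ⟨S, hS1, hS2, hS3⟩ := ih (a + 2)
      have hdis : Disjoint (H.maxGenEigenspace a ⊓ LinearMap.ker E) S := by
        have := (Module.End.independent_maxGenEigenspace H) a
        refine this.mono inf_le_left (hS2.trans ?_)
        refine iSup_le fun i => ?_
        have hne : a + 2 + 2 * (i : F) ≠ a := by
          intro h
          have h' : (2 : F) * ((i + 1 : ℕ) : F) = 0 := by
            push_cast
            linear_combination h
          simp only [mul_eq_zero, two_ne_zero, false_or, Nat.cast_eq_zero] at h'
          omega
        exact le_iSup₂_of_le (a + 2 + 2 * (i : F)) hne le_rfl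
      refine ⟨(H.maxGenEigenspace a ⊓ LinearMap.ker E) ⊔ S, sup_le inf_le_right hS1,
        sup_le ?_ ?_, ?_⟩
      · refine inf_le_left.trans ?_
        refine le_iSup_of_le 0 ?_
        simp
      · refine hS2.trans (iSup_le fun i => ?_)
        refine le_iSup_of_le (i + 1) ?_
        have : a + 2 + 2 * (i : F) = a + 2 * ((i + 1 : ℕ) : F) := by push_cast; ring
        rw [this]
      · let W := H.maxGenEigenspace a ⊓ LinearMap.ker (E ^ (n + 1))
        have h1 := (E.domRestrict W).finrank_range_add_finrank_ker
        have h2 : finrank F (LinearMap.range (E.domRestrict W)) ≤ finrank F S := by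
          refine le_trans (Submodule.finrank_mono ?_) hS3
          rintro _ ⟨⟨w, hw1, hw2⟩, rfl⟩
          refine ⟨hEH a w hw1, ?_⟩
          have hw3 : (E ^ (n + 1)) w = 0 := hw2
          rw [pow_succ, Module.End.mul_apply] at hw3
          exact hw3
        have h3 : finrank F (LinearMap.ker (E.domRestrict W)) ≤
            finrank F ↥(H.maxGenEigenspace a ⊓ LinearMap.ker E) := by
          rw [← Submodule.finrank_map_subtype_eq W]
          refine Submodule.finrank_mono ?_
          rintro _ ⟨⟨w, hw1, hw2⟩, hw3, rfl⟩
          exact ⟨hw1, hw3⟩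
        have h4 := Submodule.finrank_sup_add_finrank_inf_eq
          (H.maxGenEigenspace a ⊓ LinearMap.ker E) S
        rw [hdis.eq_bot, finrank_bot, add_zero] at h4
        rw [h4]
        change finrank F W ≤ _
        omega
  obtain ⟨n, hn⟩ := hE
  obtain ⟨S, hS1, -, hS3⟩ := key n 0
  rw [hn, LinearMap.ker_zero, inf_top_eq] at hS3
  exact hS3.trans (Submodule.finrank_mono hS1)

lemma genEig_int_induction {F V : Type*} [Field F] [IsAlgClosed F] [AddCommGroup V]
    [Module F V] [FiniteDimensional F V] (T : Module.End F V)
    (hIntEig : ∀ μ, T.HasEigenvalue μ → ∃ j : ℤ, μ = j) {p : V → Prop}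
    (h0 : p 0) (hadd : ∀ x y, p x → p y → p (x + y))
    (h : ∀ j : ℤ, ∀ x ∈ T.maxGenEigenspace (j : F), p x)
    (x : V) : p x := by
  refine genEig_induction T (fun μ x hx => ?_) h0 hadd x
  by_cases hμ : T.HasEigenvalue μ
  · obtain ⟨j, rfl⟩ := hIntEig μ hμ
    exact h j x hx
  · have hb : T.maxGenEigenspace μ = ⊥ := by
      by_contra hne
      exact hμ ((Module.End.hasUnifEigenvalue_iff_hasUnifEigenvalue_one (k := ⊤) (by simp)).mp hne)
    rw [hb] at hx
    rw [(Submodule.mem_bot F).mp hx]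
    exact h0

lemma exists_family_grading {F A L : Type*} [Field F] [IsAlgClosed F] [CharZero F] [CommRing A]
    [Algebra F A] [LieRing L] [LieAlgebra F L] [FiniteDimensional F L] (ε₀ ε₁ : A →ₐ[F] F)
    (t : ℤ → A) (ht : ∀ i j, t (i + j) = t i * t j) (ht0 : ∀ i, ε₀ (t i) = 1)
    (D : Module.End F L) (hD : ∀ x y, D ⁅x, y⁆ = ⁅D x, y⁆ + ⁅x, D y⁆)
    (hIntEig : ∀ μ, D.HasEigenvalue μ → ∃ j : ℤ, μ = j) :
    ∃ (Φ : A ⊗[F] L →ₗ[A] A ⊗[F] L) (ρ : L →ₗ[F] L), IsFamily ε₀ ε₁ Φ ρ ∧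
      ∀ j : ℤ, ∀ x ∈ D.maxGenEigenspace (j : F), ρ x = ε₁ (t j) • x := by
  have hinv : ∀ j : ℤ, Function.invFun (Int.cast : ℤ → F) (j : F) = j :=
    Function.leftInverse_invFun Int.cast_injective
  obtain ⟨r, hr'⟩ := exists_linear_on_genEig D
    (fun μ => TensorProduct.mk F A L (t (Function.invFun (Int.cast : ℤ → F) μ)))
  have hr : ∀ j : ℤ, ∀ x ∈ D.maxGenEigenspace (j : F), r x = t j ⊗ₜ x := by
    intro j x hx
    rw [hr' _ x hx, hinv]
    rfl
  have hrl : ∀ x y, r ⁅x, y⁆ = ⁅r x, r y⁆ := by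
    intro x y
    induction x using genEig_int_induction D hIntEig with
    | h0 => simp
    | hadd x x' h h' => simp [h, h']
    | h i x hx =>
    induction y using genEig_int_induction D hIntEig with
    | h0 => simp
    | hadd x x' h h' => simp [h, h']
    | h j y hy =>
      rw [hr i x hx, hr j y hy, ExtendScalars.bracket_tmul, ← ht, hr]
      push_cast
      exact lie_mem_genEig_der D hD hx hy
  have hr0 : ∀ x, spec ε₀ (r x) = x := by
    intro x
    induction x using genEig_int_induction D hIntEig with
    | h0 => simp
    | hadd x x' h h' => simp [h, h']
    | h i x hx => rw [hr i x hx, spec_tmul, ht0, one_smul]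
  have hΦ : ∀ (a : A) (x : L), LinearMap.liftBaseChange A r (a ⊗ₜ x) = a • r x := by
    intro a x; simp
  refine ⟨LinearMap.liftBaseChange A r, (spec ε₁) ∘ₗ r, ⟨?_, ?_, ?_⟩, ?_⟩
  · intro z w
    induction z with
    | zero => simp
    | add x y hx hy => rw [add_lie, map_add, hx, hy, map_add, add_lie]
    | tmul a x =>
    induction w with
    | zero => simp
    | add x y hx hy => rw [lie_add, map_add, hx, hy, map_add, lie_add]
    | tmul b y =>
      rw [ExtendScalars.bracket_tmul, hΦ, hΦ, hΦ, hrl, smul_lie, lie_smul, mul_smul]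
  · intro z
    induction z with
    | zero => simp
    | add x y hx hy => rw [map_add, map_add, hx, hy, map_add]
    | tmul a x => rw [hΦ, spec_smul, hr0, spec_tmul]
  · intro z
    induction z with
    | zero => simp
    | add x y hx hy => rw [map_add, map_add, hx, hy, map_add, map_add]
    | tmul a x => rw [hΦ, spec_smul, spec_tmul, map_smul]; rfl
  · intro j x hx
    rw [LinearMap.comp_apply, hr j x hx, spec_tmul]

lemma fix_of_unipotent {F V : Type*} [Field F] [CharZero F] [AddCommGroup V] [Module F V]
    (S : Module.End F V) (m n : ℕ) (hm : 1 ≤ m) (x : V) (h1 : ((S - 1) ^ n) x = 0)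
    (h2 : (S ^ m) x = x) : S x = x := by
  have hcop : IsCoprime ((Polynomial.X - Polynomial.C (1 : F)) ^ n)
      (∑ i ∈ Finset.range m, Polynomial.X ^ i) := by
    apply IsCoprime.pow_left
    rw [(Polynomial.irreducible_X_sub_C (1 : F)).coprime_iff_not_dvd, Polynomial.dvd_iff_isRoot,
      Polynomial.IsRoot, Polynomial.eval_finsetSum]
    simp
    omega
  obtain ⟨a, b, hab⟩ := hcop
  have h3 := congrArg (fun p => Polynomial.aeval S (p * (Polynomial.X - Polynomial.C (1 : F))) x) hab
  have h4 : (a * (Polynomial.X - Polynomial.C (1 : F)) ^ n +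
      b * ∑ i ∈ Finset.range m, Polynomial.X ^ i) * (Polynomial.X - Polynomial.C (1 : F)) =
      (a * (Polynomial.X - Polynomial.C (1 : F))) * (Polynomial.X - Polynomial.C (1 : F)) ^ n +
      b * (Polynomial.X ^ m - 1) := by
    rw [← geom_sum_mul (Polynomial.X : Polynomial F) m]
    simp only [map_one]
    ring
  simp only [h4] at h3
  rw [one_mul, map_add, map_mul _ _ ((Polynomial.X - Polynomial.C (1 : F)) ^ n), map_mul _ b,
    LinearMap.add_apply, Module.End.mul_apply, Module.End.mul_apply] at h3
  have h5 : (Polynomial.aeval S ((Polynomial.X - Polynomial.C (1 : F)) ^ n)) x = 0 := by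
    simpa using h1
  have h6 : (Polynomial.aeval S (Polynomial.X ^ m - 1 : Polynomial F)) x = 0 := by
    simp [h2]
  rw [h5, h6] at h3
  simp at h3
  exact sub_eq_zero.mp h3.symm

lemma fix_of_finrank_le {F V : Type*} [Field F] [IsAlgClosed F] [CharZero F] [AddCommGroup V]
    [Module F V] [FiniteDimensional F V] (D θ ρ : Module.End F V)
    (hIntEig : ∀ μ, D.HasEigenvalue μ → ∃ j : ℤ, μ = j)
    (hρ : ∀ j : ℤ, ∀ x ∈ D.maxGenEigenspace (j : F), ρ x = (2 : F) ^ j • x)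
    (hc : Commute D θ) (m : ℕ) (hm : 1 ≤ m) (hθ : θ ^ m = 1)
    (hle : finrank F (D.maxGenEigenspace 0) ≤ finrank F (Module.End.maxGenEigenspace (θ ∘ₗ ρ) 1)) :
    ∀ x ∈ D.maxGenEigenspace 0, θ x = x := by
  have hinv : ∀ j : ℤ, Function.invFun (Int.cast : ℤ → F) (j : F) = j :=
    Function.leftInverse_invFun Int.cast_injective
  have hθD : ∀ μ, ∀ x ∈ D.maxGenEigenspace μ, θ x ∈ D.maxGenEigenspace μ := fun μ x hx =>
    Module.End.mapsTo_maxGenEigenspace_of_comm hc μ hx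
  have hθρ : Commute θ ρ := by
    apply LinearMap.ext
    intro x
    rw [Module.End.mul_apply, Module.End.mul_apply]
    induction x using genEig_int_induction D hIntEig with
    | h0 => simp
    | hadd x x' h h' => simp [h, h']
    | h i x hx => rw [hρ i x hx, hρ i _ (hθD _ x hx), map_smul]
  let S : Module.End F V := θ * ρ
  have hS : S ^ m = ρ ^ m := by rw [hθρ.mul_pow, hθ, one_mul]
  have hρm : ∀ j : ℤ, ∀ x ∈ D.maxGenEigenspace (j : F), (ρ ^ m) x = (2 : F) ^ (j * m) • x := by
    intro j x hx
    rw [zpow_mul, zpow_natCast]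
    clear hθ hS hm
    induction m with
    | zero => simp
    | succ m ih =>
      rw [pow_succ', Module.End.mul_apply, ih, map_smul, hρ j x hx, smul_smul, pow_succ]
  classical
  obtain ⟨P, hP⟩ := exists_linear_on_genEig D (fun μ => if μ = 0 then LinearMap.id else 0)
  have hP0 : ∀ y, P y ∈ D.maxGenEigenspace 0 := by
    intro y
    induction y using genEig_int_induction D hIntEig with
    | h0 => simp
    | hadd x x' h h' => rw [map_add]; exact add_mem h h'
    | h i x hx =>
      rw [hP _ x hx]
      split_ifs with h
      · rw [h] at hx; simpa using hx
      · simp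
  obtain ⟨Q, hQ'⟩ := exists_linear_on_genEig D (fun μ =>
    ((2 : F) ^ (Function.invFun (Int.cast : ℤ → F) μ * m) - 1)⁻¹ • (LinearMap.id : V →ₗ[F] V))
  have hQ : ∀ j : ℤ, ∀ x ∈ D.maxGenEigenspace (j : F), Q x = ((2 : F) ^ (j * m) - 1)⁻¹ • x := by
    intro j x hx
    rw [hQ' _ x hx, hinv]
    rfl
  have hQR : ∀ y, Q ((ρ ^ m - 1) y) = y - P y := by
    intro y
    induction y using genEig_int_induction D hIntEig with
    | h0 => simp
    | hadd x x' h h' => rw [map_add, map_add, h, h', map_add]; abel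
    | h i x hx =>
      rw [LinearMap.sub_apply, Module.End.one_apply, hρm i x hx, map_sub, map_smul, hQ i x hx,
        hP _ x hx]
      by_cases hi : i = 0
      · simp [hi]
      · have h1 : (2 : F) ^ (i * m) - 1 ≠ 0 := by
          rw [sub_ne_zero]
          intro h
          have h2 : (2 : ℚ) ^ (i * m) = 1 := by
            have : (((2 : ℚ) ^ (i * m) : ℚ) : F) = ((1 : ℚ) : F) := by push_cast; exact h
            exact_mod_cast this
          rw [zpow_eq_one_iff_right₀ (by norm_num) (by norm_num)] at h2
          simp [hi] at h2
          omega
        rw [if_neg (by simpa using hi)]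
        rw [smul_smul, ← sub_smul]
        have h2 : (2 : F) ^ (i * m) * ((2 : F) ^ (i * m) - 1)⁻¹ - ((2 : F) ^ (i * m) - 1)⁻¹ = 1 := by
          field_simp
        rw [h2]
        simp
  have hstep : ∀ y, (ρ ^ m - 1) y ∈ D.maxGenEigenspace 0 → y ∈ D.maxGenEigenspace 0 := by
    intro y hy
    have h1 := hQR y
    rw [hQ 0 _ (by simpa using hy)] at h1
    simp at h1
    rw [sub_eq_zero.mp h1.symm]
    exact hP0 y
  have hstep2 : ∀ (n : ℕ) (y : V), ((ρ ^ m - 1) ^ n) y ∈ D.maxGenEigenspace 0 → y ∈ D.maxGenEigenspace 0 := by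
    intro n
    induction n with
    | zero => intro y hy; simpa using hy
    | succ n ih =>
      intro y hy
      rw [pow_succ, Module.End.mul_apply] at hy
      exact hstep y (ih _ hy)
  have hsub : Module.End.maxGenEigenspace S 1 ≤ D.maxGenEigenspace 0 := by
    intro x hx
    rw [Module.End.mem_maxGenEigenspace] at hx
    obtain ⟨n, hn⟩ := hx
    apply hstep2 n x
    rw [one_smul] at hn
    have hcm : Commute (∑ i ∈ Finset.range m, S ^ i) (S - 1) := by
      unfold Commute SemiconjBy
      rw [geom_sum_mul, mul_geom_sum]
    rw [← hS, ← geom_sum_mul, hcm.mul_pow, Module.End.mul_apply, hn, map_zero]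
    exact zero_mem _
  have heq := Submodule.eq_of_le_of_finrank_le hsub hle
  intro x hx
  have hρx : ρ x = x := by
    have := hρ 0 x (by simpa using hx)
    simpa using this
  have hSx : S x = x := by
    have hx2 := hx
    rw [← heq, Module.End.mem_maxGenEigenspace] at hx2
    obtain ⟨n, hn⟩ := hx2
    rw [one_smul] at hn
    refine fix_of_unipotent S m n hm x hn ?_
    rw [hS, hρm 0 x (by simpa using hx)]
    simp
  have h9 : θ (ρ x) = x := hSx
  rwa [hρx] at h9

lemma exists_family_inner {F A L : Type*} [Field F] [IsAlgClosed F] [CharZero F] [CommRing A]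
    [Algebra F A] [LieRing L] [LieAlgebra F L] [FiniteDimensional F L]
    [LieAlgebra.IsSemisimple F L] {ε₀ ε₁ : A →ₐ[F] F}
    (u : A) (h0 : ε₀ u = 0) (h1 : ε₁ u = 1) (θ : L ≃ₗ[F] L) (hθ : θ ∈ IntG F L) :
    ∃ Φ : A ⊗[F] L ≃ₗ[A] A ⊗[F] L, IsFamily ε₀ ε₁ Φ.toLinearMap θ.toLinearMap := by
  unfold IntG at hθ
  induction hθ using Subgroup.closure_induction with
  | mem x hx =>
    obtain ⟨n, hn, hx⟩ := hx
    exact exists_family_exp u h0 h1 n hn x hx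
  | one => exact ⟨LinearEquiv.refl _ _, fun x y => rfl, fun z => rfl, fun z => rfl⟩
  | mul x y hx hy ihx ihy =>
    obtain ⟨Φ, hΦ⟩ := ihx
    obtain ⟨Ψ, hΨ⟩ := ihy
    exact ⟨Ψ.trans Φ, hΦ.comp hΨ⟩
  | inv x hx ih =>
    obtain ⟨Φ, hΦ⟩ := ih
    exact ⟨Φ.symm, hΦ.symm⟩

theorem theta_eq_id_on_centralizer_h
    (m : ℕ) (hm : 1 ≤ m) (ζ : k) (hζ : IsPrimitiveRoot ζ m)
    (θ : g ≃ₗ[k] g) (hθb : ∀ x y : g, θ ⁅x, y⁆ = ⁅θ x, θ y⁆) (hθm : θ ^ m = 1)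
    (hθinner : θ ∈ IntG k g)
    (e h f : g)
    (hhe : ⁅h, e⁆ = (2 : k) • e) (hhf : ⁅h, f⁆ = -((2 : k) • f)) (hef : ⁅e, f⁆ = h)
    (hθe : θ e = ζ • e) (hθh : θ h = h) (hθf : θ f = ζ⁻¹ • f)
    (hen : IsNilpotent (LieAlgebra.ad k g e))
    (her : Module.finrank k (zc k g e) = LieAlgebra.rank k g)
    : ∀ x : g, ⁅h, x⁆ = 0 → θ x = x := by
  classical
  let A := LaurentPolynomial k
  let ev : kˣ → (A →ₐ[k] k) := fun c =>
    { LaurentPolynomial.eval₂ (RingHom.id k) c with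
      commutes' := fun r => by
        have := LaurentPolynomial.eval₂_C (RingHom.id k) c r
        exact this }
  have hev : ∀ (c : kˣ) (n : ℤ), ev c (LaurentPolynomial.T n) = ((c ^ n : kˣ) : k) := fun c n =>
    LaurentPolynomial.eval₂_T (RingHom.id k) c n
  let ε₀ := ev 1
  let ε₁ := ev (Units.mk0 (2 : k) two_ne_zero)
  have hε₀ : ∀ n : ℤ, ε₀ (LaurentPolynomial.T n) = 1 := fun n => by
    rw [hev]; simp
  have hε₁ : ∀ n : ℤ, ε₁ (LaurentPolynomial.T n) = (2 : k) ^ n := fun n => by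
    rw [hev]; simp
  obtain ⟨Φ, hΦ⟩ := exists_family_inner (A := A) (ε₀ := ε₀) (ε₁ := ε₁)
    (LaurentPolynomial.T 1 - 1) (by rw [map_sub, hε₀, map_one, sub_self])
    (by rw [map_sub, hε₁, map_one, zpow_one]; norm_num) θ hθinner
  have hIntEig := sl2_eigenvalue_int e h f hhe hhf hef hen
  have hder : ∀ x y : g, (LieAlgebra.ad k g h) ⁅x, y⁆ =
      ⁅(LieAlgebra.ad k g h) x, y⁆ + ⁅x, (LieAlgebra.ad k g h) y⁆ := by
    intro x y
    simp only [LieAlgebra.ad_apply]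
    exact leibniz_lie h x y
  obtain ⟨Ψ, ρ, hΨ, hρ⟩ := exists_family_grading (A := A) ε₀ ε₁ (fun n => LaurentPolynomial.T n)
    (fun i j => LaurentPolynomial.T_add i j) hε₀ (LieAlgebra.ad k g h) hder hIntEig
  have hrank := rank_le_of_family (hΦ.comp hΨ)
  have he2 : e ∈ (LieAlgebra.ad k g h).maxGenEigenspace (2 : k) := by
    rw [Module.End.mem_maxGenEigenspace]
    exact ⟨1, by simp [hhe]⟩
  have hdim := finrank_genEig_zero_le (LieAlgebra.ad k g e) (LieAlgebra.ad k g h) hen (by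
    intro a x hx
    rw [add_comm]
    exact lie_mem_genEig_der (LieAlgebra.ad k g h) hder he2 hx)
  have hdim2 := hdim.trans ((le_of_eq her).trans hrank)
  have hfix := fix_of_finrank_le (LieAlgebra.ad k g h) θ.toLinearMap ρ hIntEig
    (fun j x hx => by rw [hρ j x hx, hε₁]) (by
      apply LinearMap.ext
      intro x
      change ⁅h, θ x⁆ = θ ⁅h, x⁆
      rw [hθb, hθh]) m hm (by
      apply LinearMap.ext
      intro x
      have h1 : ∀ n : ℕ, ∀ x, ((θ.toLinearMap : Module.End k g) ^ n) x = (θ ^ n) x := by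
        intro n
        induction n with
        | zero => intro x; rfl
        | succ n ih => intro x; rw [pow_succ, pow_succ, Module.End.mul_apply, ih]; rfl
      rw [h1, hθm]
      rfl) hdim2
  intro x hx
  apply hfix x
  rw [Module.End.mem_maxGenEigenspace]
  exact ⟨1, by simp [hx]⟩
end
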